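/- arXiv:2410.03130 — 5 statements merged into one kernel-verified Lean document; each statement's English description precedes it below -/
import Mathlib

section
/- (Third moment of the vMF distribution.) Let σ be the surface measure on the unit sphere S^{p−1} ⊂ ℝ^p (p ≥ 2), μ ∈ S^{p−1}, k > 0, and Z = ∫ e^{k⟨μ,x⟩} dσ. Then there exist scalars c ≥ 0 and d ≥ 0 such that for all u, v, w ∈ ℝ^p, (1/Z) ∫_{S^{p−1}} ⟨u,x⟩⟨v,x⟩⟨w,x⟩ e^{k⟨μ,x⟩} dσ(x) = c (⟨μ,u⟩⟨v,w⟩ + ⟨μ,v⟩⟨u,w⟩ + ⟨μ,w⟩⟨u,v⟩) + d ⟨μ,u⟩⟨μ,v⟩⟨μ,w⟩. -/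
open MeasureTheory RealInnerProductSpace

namespace VMF

open Pointwise in
lemma mp {p : ℕ} (L : EuclideanSpace ℝ (Fin p) ≃ₗᵢ[ℝ] EuclideanSpace ℝ (Fin p))
    (f : EuclideanSpace ℝ (Fin p) → ℝ) :
    ∫ x : Metric.sphere (0 : EuclideanSpace ℝ (Fin p)) 1, f (L x)
        ∂((volume : Measure (EuclideanSpace ℝ (Fin p))).toSphere) =
    ∫ x : Metric.sphere (0 : EuclideanSpace ℝ (Fin p)) 1, f x
        ∂((volume : Measure (EuclideanSpace ℝ (Fin p))).toSphere) := by
  have key : ∀ M : EuclideanSpace ℝ (Fin p) ≃ₗᵢ[ℝ] EuclideanSpace ℝ (Fin p),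
      ∀ x : Metric.sphere (0 : EuclideanSpace ℝ (Fin p)) 1,
      M x ∈ Metric.sphere (0 : EuclideanSpace ℝ (Fin p)) 1 := by
    intro M x
    have := x.2
    simp only [mem_sphere_zero_iff_norm] at this ⊢
    rw [M.norm_map, this]
  let g : Metric.sphere (0 : EuclideanSpace ℝ (Fin p)) 1 ≃ₜ
      Metric.sphere (0 : EuclideanSpace ℝ (Fin p)) 1 :=
    { toFun := fun x => ⟨L x, key L x⟩
      invFun := fun x => ⟨L.symm x, key L.symm x⟩
      left_inv := fun x => by simp
      right_inv := fun x => by simp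
      continuous_toFun := by fun_prop
      continuous_invFun := by fun_prop }
  have hg : MeasurePreserving g
      (volume : Measure (EuclideanSpace ℝ (Fin p))).toSphere
      (volume : Measure (EuclideanSpace ℝ (Fin p))).toSphere := by
    refine ⟨g.continuous.measurable, ?_⟩
    ext s hs
    rw [Measure.map_apply g.continuous.measurable hs, Measure.toSphere_apply' _ hs,
      Measure.toSphere_apply' _ (g.continuous.measurable hs)]
    congr 1
    have : Set.Ioo (0:ℝ) 1 • ((fun x : Metric.sphere (0 : EuclideanSpace ℝ (Fin p)) 1 =>
        (x : EuclideanSpace ℝ (Fin p))) '' (g ⁻¹' s)) = L.toMeasurableEquiv ⁻¹' (Set.Ioo (0:ℝ) 1 •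
        ((fun x : Metric.sphere (0 : EuclideanSpace ℝ (Fin p)) 1 =>
        (x : EuclideanSpace ℝ (Fin p))) '' s)) := by
      ext y
      simp only [Set.mem_smul, Set.mem_image, Set.mem_preimage]
      constructor
      · rintro ⟨r, hr, _, ⟨x, hx, rfl⟩, rfl⟩
        refine ⟨r, hr, _, ⟨g x, hx, rfl⟩, ?_⟩
        exact (L.map_smul r (x : EuclideanSpace ℝ (Fin p))).symm
      · rintro ⟨r, hr, _, ⟨x, hx, rfl⟩, h⟩
        refine ⟨r, hr, _, ⟨g.symm x, by simpa using hx, rfl⟩, ?_⟩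
        apply L.injective
        rw [L.map_smul]
        refine Eq.trans ?_ h
        congr 1
        exact L.apply_symm_apply _
    rw [this]
    exact (L.measurePreserving).measure_preimage_equiv _
  exact hg.integral_comp g.measurableEmbedding (fun x => f x)

/-- unnormalized third moment -/
noncomputable def F {p : ℕ} (k : ℝ) (m u v w : EuclideanSpace ℝ (Fin p)) : ℝ :=
  ∫ x : Metric.sphere (0 : EuclideanSpace ℝ (Fin p)) 1,
            ⟪u, (x : EuclideanSpace ℝ (Fin p))⟫ * ⟪v, (x : EuclideanSpace ℝ (Fin p))⟫ *
              ⟪w, (x : EuclideanSpace ℝ (Fin p))⟫ *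
              Real.exp (k * ⟪m, (x : EuclideanSpace ℝ (Fin p))⟫)
            ∂((volume : Measure (EuclideanSpace ℝ (Fin p))).toSphere)

variable {p : ℕ} (k : ℝ)

lemma integ {f : Metric.sphere (0 : EuclideanSpace ℝ (Fin p)) 1 → ℝ} (hf : Continuous f) :
    Integrable f ((volume : Measure (EuclideanSpace ℝ (Fin p))).toSphere) :=
  hf.integrable_of_hasCompactSupport (HasCompactSupport.of_compactSpace f)

lemma integF (m u v w : EuclideanSpace ℝ (Fin p)) :
    Integrable (fun x : Metric.sphere (0 : EuclideanSpace ℝ (Fin p)) 1 =>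
            ⟪u, (x : EuclideanSpace ℝ (Fin p))⟫ * ⟪v, (x : EuclideanSpace ℝ (Fin p))⟫ *
              ⟪w, (x : EuclideanSpace ℝ (Fin p))⟫ *
              Real.exp (k * ⟪m, (x : EuclideanSpace ℝ (Fin p))⟫))
      ((volume : Measure (EuclideanSpace ℝ (Fin p))).toSphere) := by
  apply integ
  fun_prop

lemma F_swap12 (m u v w : EuclideanSpace ℝ (Fin p)) : F k m u v w = F k m v u w := by
  unfold F
  congr 1
  ext x
  ring

lemma F_swap23 (m u v w : EuclideanSpace ℝ (Fin p)) : F k m u v w = F k m u w v := by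
  unfold F
  congr 1
  ext x
  ring

lemma F_add1 (m u u' v w : EuclideanSpace ℝ (Fin p)) :
    F k m (u + u') v w = F k m u v w + F k m u' v w := by
  unfold F
  rw [← integral_add (integF k m u v w) (integF k m u' v w)]
  congr 1
  ext x
  rw [inner_add_left]
  ring

lemma F_smul1 (a : ℝ) (m u v w : EuclideanSpace ℝ (Fin p)) :
    F k m (a • u) v w = a * F k m u v w := by
  unfold F
  rw [← integral_const_mul]
  congr 1
  ext x
  rw [real_inner_smul_left]
  ring

lemma F_add2 (m u v v' w : EuclideanSpace ℝ (Fin p)) :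
    F k m u (v + v') w = F k m u v w + F k m u v' w := by
  rw [F_swap12, F_add1, F_swap12, F_swap12 k m v']

lemma F_smul2 (a : ℝ) (m u v w : EuclideanSpace ℝ (Fin p)) :
    F k m u (a • v) w = a * F k m u v w := by
  rw [F_swap12, F_smul1, F_swap12]

lemma F_add3 (m u v w w' : EuclideanSpace ℝ (Fin p)) :
    F k m u v (w + w') = F k m u v w + F k m u v w' := by
  rw [F_swap23, F_add2, F_swap23, F_swap23 k m u w']

lemma F_smul3 (a : ℝ) (m u v w : EuclideanSpace ℝ (Fin p)) :
    F k m u v (a • w) = a * F k m u v w := by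
  rw [F_swap23, F_smul2, F_swap23]

lemma F_neg1 (m u v w : EuclideanSpace ℝ (Fin p)) : F k m (-u) v w = - F k m u v w := by
  simpa using F_smul1 k (-1) m u v w

lemma F_neg2 (m u v w : EuclideanSpace ℝ (Fin p)) : F k m u (-v) w = - F k m u v w := by
  simpa using F_smul2 k (-1) m u v w

lemma F_neg3 (m u v w : EuclideanSpace ℝ (Fin p)) : F k m u v (-w) = - F k m u v w := by
  simpa using F_smul3 k (-1) m u v w

lemma F_map (L : EuclideanSpace ℝ (Fin p) ≃ₗᵢ[ℝ] EuclideanSpace ℝ (Fin p))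
    (m u v w : EuclideanSpace ℝ (Fin p)) :
    F k (L m) (L u) (L v) (L w) = F k m u v w := by
  unfold F
  rw [← mp L (fun x => ⟪L u, x⟫ * ⟪L v, x⟫ * ⟪L w, x⟫ * Real.exp (k * ⟪L m, x⟫))]
  simp only [LinearIsometryEquiv.inner_map_map]

lemma F_negm (m u v w : EuclideanSpace ℝ (Fin p)) : F k (-m) u v w = - F k m u v w := by
  have := F_map k (LinearIsometryEquiv.neg ℝ) m u v w
  simp only [LinearIsometryEquiv.coe_neg, F_neg1, F_neg2, F_neg3] at this
  linarith

lemma exists_swap (a b : EuclideanSpace ℝ (Fin p)) (h : ‖a‖ = ‖b‖) :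
    ∃ L : EuclideanSpace ℝ (Fin p) ≃ₗᵢ[ℝ] EuclideanSpace ℝ (Fin p),
      L a = b ∧ L b = a ∧ ∀ z, ⟪a - b, z⟫ = 0 → L z = z := by
  have h1 := Submodule.reflection_sub h
  refine ⟨Submodule.reflection (Submodule.span ℝ {a - b})ᗮ, h1, ?_, ?_⟩
  · have h2 := Submodule.reflection_reflection (Submodule.span ℝ {a - b})ᗮ a
    rw [h1] at h2
    exact h2
  · intro z hz
    apply Submodule.reflection_mem_subspace_eq_self
    exact Submodule.mem_orthogonal_singleton_iff_inner_right.2 hz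

lemma sinh_id (a b c : ℝ) (h : a + b + c = 0) :
    (Real.exp a - Real.exp (-a)) + (Real.exp b - Real.exp (-b)) + (Real.exp c - Real.exp (-c))
      = 8 * (Real.sinh (a / 2) * Real.sinh (b / 2) * Real.sinh (c / 2)) := by
  obtain rfl : c = -a - b := by linarith
  have ea : Real.exp a = Real.exp (a/2) ^ 2 := by rw [← Real.exp_nat_mul]; congr 1; push_cast; ring
  have eb : Real.exp b = Real.exp (b/2) ^ 2 := by rw [← Real.exp_nat_mul]; congr 1; push_cast; ring
  have hc1 : Real.exp (-a - b) = (Real.exp a)⁻¹ * (Real.exp b)⁻¹ := by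
    rw [← Real.exp_neg, ← Real.exp_neg, ← Real.exp_add]; congr 1
  have hc2 : Real.exp (-(-a - b)) = Real.exp a * Real.exp b := by
    rw [← Real.exp_add]; congr 1; ring
  have hc3 : Real.exp ((-a - b)/2) = (Real.exp (a/2))⁻¹ * (Real.exp (b/2))⁻¹ := by
    rw [← Real.exp_neg, ← Real.exp_neg, ← Real.exp_add]; congr 1; ring
  have hc4 : Real.exp (-((-a - b)/2)) = Real.exp (a/2) * Real.exp (b/2) := by
    rw [← Real.exp_add]; congr 1; ring
  simp only [Real.sinh_eq, hc1, hc2, hc3, hc4]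
  simp only [Real.exp_neg, ea, eb]
  have := Real.exp_pos (a/2)
  have := Real.exp_pos (b/2)
  field_simp
  ring

lemma mul_sinh_nonneg (hk : 0 < k) (a : ℝ) : 0 ≤ a * Real.sinh (k * a / 2) := by
  rcases le_total 0 a with h | h
  · exact mul_nonneg h (Real.sinh_nonneg_iff.2 (by positivity))
  · exact mul_nonneg_of_nonpos_of_nonpos h (Real.sinh_nonpos_iff.2 (by nlinarith))

lemma F_tri (hk : 0 < k) (a b c : EuclideanSpace ℝ (Fin p)) (ha : ‖a‖ = 1) (hb : ‖b‖ = 1)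
    (hc : ‖c‖ = 1) (h : a + b + c = 0) (h1 : ⟪a, b⟫ = ⟪a, c⟫) (h2 : ⟪a, b⟫ = ⟪b, c⟫) :
    0 ≤ F k a a b c := by
  have e1 : F k b a b c = F k a a b c := by
    obtain ⟨L, hL1, hL2, hL3⟩ := exists_swap a b (ha.trans hb.symm)
    have := F_map k L a a b c
    rw [hL1, hL2, hL3 c (by rw [inner_sub_left]; linarith)] at this
    rw [← this, F_swap12]
  have e2 : F k c a b c = F k a a b c := by
    obtain ⟨L, hL1, hL2, hL3⟩ := exists_swap a c (ha.trans hc.symm)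
    have := F_map k L a a b c
    rw [hL1, hL2, hL3 b (by rw [inner_sub_left, real_inner_comm b c]; linarith)] at this
    rw [← this, F_swap23, F_swap12, F_swap23]
  have e3 : F k a a b c + F k b a b c + F k c a b c + -(F k (-a) a b c) + -(F k (-b) a b c)
      + -(F k (-c) a b c) = 6 * F k a a b c := by
    rw [F_negm, F_negm, F_negm, e1, e2]; ring
  suffices 0 ≤ F k a a b c + F k b a b c + F k c a b c + -(F k (-a) a b c) + -(F k (-b) a b c)
      + -(F k (-c) a b c) by linarith
  rw [← F_neg1, ← F_neg1, ← F_neg1]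
  unfold F
  rw [← integral_add, ← integral_add, ← integral_add, ← integral_add, ← integral_add]
  rotate_left
  iterate 10 exact integ (by fun_prop)
  apply integral_nonneg
  intro x
  have hs : ⟪a, (x : EuclideanSpace ℝ (Fin p))⟫ + ⟪b, (x : EuclideanSpace ℝ (Fin p))⟫
      + ⟪c, (x : EuclideanSpace ℝ (Fin p))⟫ = 0 := by
    rw [← inner_add_left, ← inner_add_left, h, inner_zero_left]
  simp only [inner_neg_left, Pi.zero_apply]
  generalize ⟪a, (x : EuclideanSpace ℝ (Fin p))⟫ = A at *
  generalize ⟪b, (x : EuclideanSpace ℝ (Fin p))⟫ = B at *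
  generalize ⟪c, (x : EuclideanSpace ℝ (Fin p))⟫ = C at *
  have := sinh_id (k * A) (k * B) (k * C) (by rw [← mul_add, ← mul_add, hs, mul_zero])
  have hp := mul_nonneg (mul_nonneg (mul_sinh_nonneg k hk A) (mul_sinh_nonneg k hk B))
    (mul_sinh_nonneg k hk C)
  have e : ∀ t, k * -t = -(k * t) := fun t => by ring
  simp only [e]
  linear_combination 8 * hp - A * B * C * this

lemma F_c (hk : 0 < k) (a e : EuclideanSpace ℝ (Fin p)) : 0 ≤ F k a a e e := by
  have e3 : F k a a e e + F k (-a) (-a) e e = 2 * F k a a e e := by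
    rw [F_negm, F_neg1]; ring
  suffices 0 ≤ F k a a e e + F k (-a) (-a) e e by linarith
  unfold F
  rw [← integral_add (integF _ _ _ _ _) (integF _ _ _ _ _)]
  apply integral_nonneg
  intro x
  simp only [inner_neg_left, Pi.zero_apply]
  generalize ⟪a, (x : EuclideanSpace ℝ (Fin p))⟫ = A at *
  generalize ⟪e, (x : EuclideanSpace ℝ (Fin p))⟫ = B at *
  have h1 : 0 ≤ A * (Real.exp (k * A) - Real.exp (k * -A)) := by
    rcases le_total 0 A with h | h
    · exact mul_nonneg h (sub_nonneg.2 (Real.exp_le_exp.2 (by nlinarith)))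
    · exact mul_nonneg_of_nonpos_of_nonpos h (sub_nonpos.2 (Real.exp_le_exp.2 (by nlinarith)))
  have := mul_nonneg h1 (mul_self_nonneg B)
  linear_combination this

lemma F_d (hk : 0 < k) (m e : EuclideanSpace ℝ (Fin p)) (hm : ‖m‖ = 1) (he : ‖e‖ = 1)
    (h : ⟪m, e⟫ = 0) : 0 ≤ F k m m m m - 3 * F k m m e e := by
  have h3 : √3 * √3 = 3 := Real.mul_self_sqrt (by norm_num)
  have hmm : ⟪m, m⟫ = 1 := by rw [real_inner_self_eq_norm_sq, hm]; norm_num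
  have hee : ⟪e, e⟫ = 1 := by rw [real_inner_self_eq_norm_sq, he]; norm_num
  have h' : ⟪e, m⟫ = 0 := by rw [real_inner_comm]; exact h
  have nrm : ∀ x : EuclideanSpace ℝ (Fin p), ⟪x, x⟫ = 1 → ‖x‖ = 1 := by
    intro x hx
    rw [norm_eq_sqrt_real_inner, hx, Real.sqrt_one]
  have key := F_tri k hk m ((-1/2 : ℝ) • m + (√3/2) • e) ((-1/2 : ℝ) • m + (-√3/2) • e) hm
    (nrm _ ?_) (nrm _ ?_) (by module) ?_ ?_
  · simp only [F_add2, F_add3, F_smul2, F_smul3] at key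
    rw [F_swap23 k m m e m] at key
    linear_combination 4 * key - F k m m e e * h3
  all_goals
    simp only [inner_add_left, inner_add_right, real_inner_smul_left, real_inner_smul_right,
      hmm, hee, h, h']
    first
    | linear_combination (1/4) * h3
    | linear_combination (-1/4) * h3
    | ring

lemma F_main (m e0 : EuclideanSpace ℝ (Fin p)) (hm : ‖m‖ = 1) (he : ‖e0‖ = 1)
    (h : ⟪m, e0⟫ = 0) (u v w : EuclideanSpace ℝ (Fin p)) :
    F k m u v w = F k m m e0 e0 *
        (⟪m, u⟫ * ⟪v, w⟫ + ⟪m, v⟫ * ⟪u, w⟫ + ⟪m, w⟫ * ⟪u, v⟫)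
      + (F k m m m m - 3 * F k m m e0 e0) * (⟪m, u⟫ * ⟪m, v⟫ * ⟪m, w⟫) := by
  have hmm : ⟪m, m⟫ = 1 := by rw [real_inner_self_eq_norm_sq, hm]; norm_num
  -- reflection fixing `m` and negating its orthogonal complement
  obtain ⟨L, hL1, hL2⟩ : ∃ L : EuclideanSpace ℝ (Fin p) ≃ₗᵢ[ℝ] EuclideanSpace ℝ (Fin p),
      L m = m ∧ ∀ z, ⟪m, z⟫ = 0 → L z = -z := by
    refine ⟨Submodule.reflection (Submodule.span ℝ {m}), ?_, ?_⟩
    · exact Submodule.reflection_mem_subspace_eq_self (Submodule.mem_span_singleton_self m)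
    · intro z hz
      exact Submodule.reflection_mem_subspace_orthogonalComplement_eq_neg
        (Submodule.mem_orthogonal_singleton_iff_inner_right.2 hz)
  have z1 : ∀ e, ⟪m, e⟫ = 0 → F k m m m e = 0 := by
    intro e he
    have := F_map k L m m m e
    rw [hL1, hL2 e he, F_neg3] at this
    linarith
  have z3 : ∀ e f g, ⟪m, e⟫ = 0 → ⟪m, f⟫ = 0 → ⟪m, g⟫ = 0 → F k m e f g = 0 := by
    intro e f g he hf hg
    have := F_map k L m e f g
    rw [hL1, hL2 e he, hL2 f hf, hL2 g hg, F_neg3, F_neg2, F_neg1] at this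
    linarith
  have q : ∀ e, ⟪m, e⟫ = 0 → F k m m e e = F k m m e0 e0 * ⟪e, e⟫ := by
    intro e hme
    obtain ⟨R, hR1, hR2, hR3⟩ := exists_swap (‖e‖ • e0) e (by simp [norm_smul, he])
    have := F_map k R m m e e
    rw [hR2, hR3 m (by
      rw [inner_sub_left, real_inner_smul_left, real_inner_comm, h, real_inner_comm, hme]; simp),
      F_smul2, F_smul3] at this
    rw [← this, real_inner_self_eq_norm_sq]
    ring
  have q2 : ∀ e f, ⟪m, e⟫ = 0 → ⟪m, f⟫ = 0 → F k m m e f = F k m m e0 e0 * ⟪e, f⟫ := by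
    intro e f he hf
    have := q (e + f) (by rw [inner_add_right, he, hf, add_zero])
    simp only [F_add2, F_add3, inner_add_left, inner_add_right] at this
    rw [q e he, q f hf, F_swap23 k m m f e, real_inner_comm e f] at this
    linarith
  have dec : ∀ u : EuclideanSpace ℝ (Fin p), ∃ (a : ℝ) (u' : EuclideanSpace ℝ (Fin p)), u = a • m + u' ∧ ⟪m, u'⟫ = 0 := by
    intro u
    refine ⟨⟪m, u⟫, u - ⟪m, u⟫ • m, by module, ?_⟩
    rw [inner_sub_right, real_inner_smul_right, hmm]; ring
  obtain ⟨a, u, rfl, hu⟩ := dec u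
  obtain ⟨b, v, rfl, hv⟩ := dec v
  obtain ⟨c, w, rfl, hw⟩ := dec w
  have hu' : ⟪u, m⟫ = 0 := by rw [real_inner_comm]; exact hu
  have hv' : ⟪v, m⟫ = 0 := by rw [real_inner_comm]; exact hv
  have hw' : ⟪w, m⟫ = 0 := by rw [real_inner_comm]; exact hw
  simp only [F_add1, F_add2, F_add3, F_smul1, F_smul2, F_smul3, inner_add_left, inner_add_right,
    real_inner_smul_left, real_inner_smul_right, hmm, hu, hv, hw, hu', hv', hw']
  have s1 : F k m u v m = F k m m u v := by rw [F_swap23, F_swap12]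
  have s2 : F k m u m w = F k m m u w := F_swap12 _ _ _ _ _
  have s3 : F k m u m m = 0 := by rw [F_swap12, F_swap23, z1 u hu]
  have s4 : F k m m v m = 0 := by rw [F_swap23, z1 v hv]
  rw [s1, s2, s3, s4, z1 w hw, z3 u v w hu hv hw, q2 u v hu hv, q2 u w hu hw, q2 v w hv hw]
  ring

lemma exists_perp (hp : 2 ≤ p) (m : EuclideanSpace ℝ (Fin p)) :
    ∃ e : EuclideanSpace ℝ (Fin p), ‖e‖ = 1 ∧ ⟪m, e⟫ = 0 := by
  have hr : Module.finrank ℝ (Submodule.span ℝ {m}) ≤ 1 := by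
    simpa using finrank_span_le_card (R := ℝ) ({m} : Set (EuclideanSpace ℝ (Fin p)))
  have ht := Submodule.finrank_add_finrank_orthogonal (Submodule.span ℝ {m})
  rw [finrank_euclideanSpace_fin] at ht
  have : (Submodule.span ℝ {m})ᗮ ≠ ⊥ := by
    intro hb
    rw [hb, finrank_bot] at ht
    omega
  obtain ⟨z, hz, hz0⟩ := Submodule.exists_mem_ne_zero_of_ne_bot this
  refine ⟨‖z‖⁻¹ • z, ?_, ?_⟩
  · rw [norm_smul, norm_inv, norm_norm, inv_mul_cancel₀ (norm_ne_zero_iff.2 hz0)]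
  · rw [real_inner_smul_right, Submodule.mem_orthogonal_singleton_iff_inner_right.1 hz, mul_zero]

end VMF

/-- third moment of the vMF distribution: For the surface measure σ on
S^{p−1} ⊂ ℝ^p (p ≥ 2), μ ∈ S^{p−1}, k > 0 and Z = ∫ e^{k⟨μ,x⟩} dσ, there exist c, d ≥ 0
such that for all u, v, w ∈ ℝ^p,
(1/Z) ∫ ⟨u,x⟩⟨v,x⟩⟨w,x⟩ e^{k⟨μ,x⟩} dσ
  = c(⟨μ,u⟩⟨v,w⟩ + ⟨μ,v⟩⟨u,w⟩ + ⟨μ,w⟩⟨u,v⟩) + d⟨μ,u⟩⟨μ,v⟩⟨μ,w⟩. -/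
theorem stmt13 (p : ℕ) (hp : 2 ≤ p) (k : ℝ) (hk : 0 < k)
    (μ : EuclideanSpace ℝ (Fin p)) (hμ : ‖μ‖ = 1)
    (Z : ℝ)
    (hZ : Z = ∫ x : Metric.sphere (0 : EuclideanSpace ℝ (Fin p)) 1,
        Real.exp (k * ⟪μ, (x : EuclideanSpace ℝ (Fin p))⟫)
        ∂((volume : Measure (EuclideanSpace ℝ (Fin p))).toSphere)) :
    ∃ c d : ℝ, 0 ≤ c ∧ 0 ≤ d ∧
      ∀ u v w : EuclideanSpace ℝ (Fin p),
        (1 / Z) * (∫ x : Metric.sphere (0 : EuclideanSpace ℝ (Fin p)) 1,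
            ⟪u, (x : EuclideanSpace ℝ (Fin p))⟫ * ⟪v, (x : EuclideanSpace ℝ (Fin p))⟫ *
              ⟪w, (x : EuclideanSpace ℝ (Fin p))⟫ *
              Real.exp (k * ⟪μ, (x : EuclideanSpace ℝ (Fin p))⟫)
            ∂((volume : Measure (EuclideanSpace ℝ (Fin p))).toSphere))
          = c * (⟪μ, u⟫ * ⟪v, w⟫ + ⟪μ, v⟫ * ⟪u, w⟫ + ⟪μ, w⟫ * ⟪u, v⟫)
            + d * (⟪μ, u⟫ * ⟪μ, v⟫ * ⟪μ, w⟫) := by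
  obtain ⟨e, he, hme⟩ := VMF.exists_perp hp μ
  have hZ0 : 0 ≤ 1 / Z := by
    rw [hZ]
    exact one_div_nonneg.2 (integral_nonneg fun x => (Real.exp_pos _).le)
  refine ⟨1 / Z * VMF.F k μ μ e e, 1 / Z * (VMF.F k μ μ μ μ - 3 * VMF.F k μ μ e e),
    mul_nonneg hZ0 (VMF.F_c k hk μ e), mul_nonneg hZ0 (VMF.F_d k hk μ e hμ he hme), ?_⟩
  intro u v w
  have := VMF.F_main k μ e hμ he hme u v w
  unfold VMF.F at this ⊢
  rw [this]
  ring
end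

section
/- (Posterior-mean formula.) Let σ be the surface measure on the unit sphere S^{p−1} ⊂ ℝ^p (p ≥ 2), μ ∈ S^{p−1}, k > 0, Z = ∫ e^{k⟨μ,x⟩} dσ, and let W be a symmetric p × p real matrix. Then there exist scalars c ≥ 0 and d ≥ 0 (independent of W) such that (1/Z) ∫_{S^{p−1}} (xᵀWx) x e^{k⟨μ,x⟩} dσ(x) = 2c · Wμ + (c · Tr W + d · μᵀWμ) · μ. Consequently the (unnormalized) Bayesian posterior mean ∫ (1 + xᵀWx) x e^{k⟨μ,x⟩} dσ is a linear combination α μ + β Wμ with β ≥ 0. -/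
open MeasureTheory RealInnerProductSpace Matrix

/-- The ambient Euclidean space. -/
abbrev Eu (p : ℕ) := EuclideanSpace ℝ (Fin p)

/-- The unit sphere. -/
abbrev Sp (p : ℕ) := Metric.sphere (0 : EuclideanSpace ℝ (Fin p)) 1

/-- Surface measure. -/
noncomputable abbrev sg (p : ℕ) : Measure (Sp p) :=
  (volume : Measure (EuclideanSpace ℝ (Fin p))).toSphere

open scoped Pointwise in
lemma sphere_invariant {p : ℕ} (L : Eu p ≃ₗᵢ[ℝ] Eu p) (F : Eu p → ℝ) (hF : Continuous F) :
    ∫ x : Sp p, F (L x) ∂(sg p) = ∫ x : Sp p, F x ∂(sg p) := by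
  let φ : Sp p → Sp p := fun x => ⟨L x, by simp⟩
  have hφ : Continuous φ := by
    apply Continuous.subtype_mk
    exact L.continuous.comp continuous_subtype_val
  have hmap : Measure.map φ (sg p) = sg p := by
    ext s hs
    rw [Measure.map_apply hφ.measurable hs, Measure.toSphere_apply' _ hs,
      Measure.toSphere_apply' _ (hφ.measurable hs)]
    congr 1
    have hset : (Set.Ioo (0:ℝ) 1 • ((↑) '' (φ ⁻¹' s)) : Set (Eu p))
        = L ⁻¹' (Set.Ioo (0:ℝ) 1 • ((↑) '' s)) := by
      ext y
      simp only [Set.mem_smul, Set.mem_image, Set.mem_preimage]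
      constructor
      · rintro ⟨r, hr, z, ⟨w, hw, rfl⟩, rfl⟩
        exact ⟨r, hr, L w, ⟨φ w, hw, rfl⟩, by simp⟩
      · rintro ⟨r, hr, z, ⟨w, hw, rfl⟩, h⟩
        refine ⟨r, hr, L.symm w, ⟨⟨L.symm w, by simp⟩, ?_, rfl⟩, ?_⟩
        · simpa [φ] using hw
        · apply L.injective
          simpa using h
    rw [hset]
    exact (L.measurePreserving).measure_preimage_equiv (f := L.toMeasurableEquiv) _
  have h2 : ∫ x, F (x : Eu p) ∂(Measure.map φ (sg p)) = ∫ x, F ((φ x : Sp p) : Eu p) ∂(sg p) :=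
    integral_map hφ.measurable.aemeasurable
      (hF.comp continuous_subtype_val).aestronglyMeasurable
  rw [hmap] at h2
  exact h2.symm

lemma cont_integrable {p : ℕ} {F : Sp p → ℝ} (hF : Continuous F) : Integrable F (sg p) :=
  hF.integrable_of_hasCompactSupport (HasCompactSupport.of_compactSpace F)

lemma exists_rot {p : ℕ} (m e : Eu p) (hm : ‖m‖ = 1) (he : ‖e‖ = 1) (hme : ⟪m, e⟫ = 0) (θ : ℝ) :
    ∃ L : Eu p ≃ₗᵢ[ℝ] Eu p, ∀ x, L x = x
      + (⟪m, x⟫ * Real.cos θ - ⟪e, x⟫ * Real.sin θ - ⟪m, x⟫) • m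
      + (⟪e, x⟫ * Real.cos θ + ⟪m, x⟫ * Real.sin θ - ⟪e, x⟫) • e := by
  let l : Eu p →ₗ[ℝ] Eu p :=
    { toFun := fun x => x
        + (⟪m, x⟫ * Real.cos θ - ⟪e, x⟫ * Real.sin θ - ⟪m, x⟫) • m
        + (⟪e, x⟫ * Real.cos θ + ⟪m, x⟫ * Real.sin θ - ⟪e, x⟫) • e
      map_add' := by
        intro x y
        simp only [inner_add_right]
        module
      map_smul' := by
        intro c x
        simp only [inner_smul_right, RingHom.id_apply]
        module }
  have hl : ∀ x, ‖l x‖ = ‖x‖ := by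
    intro x
    have h1 : ‖l x‖ ^ 2 = ‖x‖ ^ 2 := by
      have hmm : ⟪m, m⟫ = 1 := by rw [real_inner_self_eq_norm_sq, hm]; norm_num
      have hee : ⟪e, e⟫ = 1 := by rw [real_inner_self_eq_norm_sq, he]; norm_num
      rw [← real_inner_self_eq_norm_sq, ← real_inner_self_eq_norm_sq]
      simp only [l, LinearMap.coe_mk, AddHom.coe_mk, inner_add_left, inner_add_right,
        inner_smul_left, inner_smul_right, hmm, hee, hme, real_inner_comm m e,
        real_inner_comm m x, real_inner_comm e x, conj_trivial]
      rw [real_inner_comm x m, real_inner_comm x e]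
      have := Real.sin_sq_add_cos_sq θ
      have hc : Real.cos θ ^ 2 = 1 - Real.sin θ ^ 2 := by linarith
      ring_nf
      simp only [hc]
      ring
    exact (sq_eq_sq₀ (norm_nonneg _) (norm_nonneg _)).1 h1
  let li : Eu p →ₗᵢ[ℝ] Eu p := ⟨l, hl⟩
  exact ⟨li.toLinearIsometryEquiv rfl, fun x => rfl⟩

lemma exists_refl {p : ℕ} (m : Eu p) (hm : ‖m‖ = 1) :
    ∃ L : Eu p ≃ₗᵢ[ℝ] Eu p, ∀ x, L x = (2 * ⟪m, x⟫) • m - x := by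
  let l : Eu p →ₗ[ℝ] Eu p :=
    { toFun := fun x => (2 * ⟪m, x⟫) • m - x
      map_add' := by
        intro x y
        simp only [inner_add_right]
        module
      map_smul' := by
        intro c x
        simp only [inner_smul_right, RingHom.id_apply]
        module }
  have hl : ∀ x, ‖l x‖ = ‖x‖ := by
    intro x
    have h1 : ‖l x‖ ^ 2 = ‖x‖ ^ 2 := by
      have hmm : ⟪m, m⟫ = 1 := by rw [real_inner_self_eq_norm_sq, hm]; norm_num
      rw [← real_inner_self_eq_norm_sq, ← real_inner_self_eq_norm_sq]
      simp only [l, LinearMap.coe_mk, AddHom.coe_mk, inner_sub_left, inner_sub_right,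
        inner_smul_left, inner_smul_right, hmm, conj_trivial]
      rw [real_inner_comm x m]
      ring
    exact (sq_eq_sq₀ (norm_nonneg _) (norm_nonneg _)).1 h1
  let li : Eu p →ₗᵢ[ℝ] Eu p := ⟨l, hl⟩
  exact ⟨li.toLinearIsometryEquiv rfl, fun x => rfl⟩

set_option maxHeartbeats 1000000 in
lemma stein_unit {p : ℕ} (m e y : Eu p) (hm : ‖m‖ = 1) (he : ‖e‖ = 1) (hme : ⟪m, e⟫ = 0)
    (hmy : ⟪m, y⟫ = 0) (g g' : ℝ → ℝ) (hg : ∀ t, HasDerivAt g (g' t) t) (hg' : Continuous g') :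
    ∫ x : Sp p, ⟪e, (x : Eu p)⟫ * ⟪y, (x : Eu p)⟫ * g' ⟪m, (x : Eu p)⟫ ∂(sg p)
      = ⟪e, y⟫ * ∫ x : Sp p, ⟪m, (x : Eu p)⟫ * g ⟪m, (x : Eu p)⟫ ∂(sg p) := by
  have hgc : Continuous g := continuous_iff_continuousAt.2 fun t => (hg t).continuousAt
  let F : ℝ → Sp p → ℝ := fun θ x =>
    (⟪y, (x : Eu p)⟫ + (⟪e, (x : Eu p)⟫ * Real.cos θ + ⟪m, (x : Eu p)⟫ * Real.sin θ
      - ⟪e, (x : Eu p)⟫) * ⟪e, y⟫)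
      * g (⟪m, (x : Eu p)⟫ * Real.cos θ - ⟪e, (x : Eu p)⟫ * Real.sin θ)
  let F' : ℝ → Sp p → ℝ := fun θ x =>
    ((⟪e, (x : Eu p)⟫ * (-Real.sin θ) + ⟪m, (x : Eu p)⟫ * Real.cos θ) * ⟪e, y⟫)
      * g (⟪m, (x : Eu p)⟫ * Real.cos θ - ⟪e, (x : Eu p)⟫ * Real.sin θ)
    + (⟪y, (x : Eu p)⟫ + (⟪e, (x : Eu p)⟫ * Real.cos θ + ⟪m, (x : Eu p)⟫ * Real.sin θ
      - ⟪e, (x : Eu p)⟫) * ⟪e, y⟫)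
      * (g' (⟪m, (x : Eu p)⟫ * Real.cos θ - ⟪e, (x : Eu p)⟫ * Real.sin θ) *
        (⟪m, (x : Eu p)⟫ * (-Real.sin θ) - ⟪e, (x : Eu p)⟫ * Real.cos θ))
  have hFc : ∀ θ, Continuous (F θ) := fun θ => by fun_prop
  have hF'c : Continuous (fun q : ℝ × Sp p => F' q.1 q.2) := by fun_prop
  have hconst : ∀ θ, ∫ x, F θ x ∂(sg p) = ∫ x, F 0 x ∂(sg p) := by
    intro θ
    obtain ⟨L, hL⟩ := exists_rot m e hm he hme θ
    have hee : ⟪e, e⟫ = 1 := by rw [real_inner_self_eq_norm_sq, he]; norm_num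
    have hmm : ⟪m, m⟫ = 1 := by rw [real_inner_self_eq_norm_sq, hm]; norm_num
    have := sphere_invariant L (fun x => ⟪y, x⟫ * g ⟪m, x⟫) (by fun_prop)
    have h0 : ∀ x : Sp p, F 0 x = ⟪y, (x : Eu p)⟫ * g ⟪m, (x : Eu p)⟫ := by
      intro x; simp [F]
    have h1 : ∀ x : Sp p, F θ x = ⟪y, L x⟫ * g ⟪m, L x⟫ := by
      intro x
      rw [hL]
      simp only [F, inner_add_right, inner_smul_right, hmm, hme, real_inner_comm m y, hmy,
        real_inner_comm e y]
      ring_nf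
    simp only [h0, h1]
    exact this
  have hcpt : IsCompact (Set.Icc (-1:ℝ) 1 ×ˢ (Set.univ : Set (Sp p))) :=
    isCompact_Icc.prod isCompact_univ
  obtain ⟨B, hB⟩ : ∃ B, ∀ q ∈ Set.Icc (-1:ℝ) 1 ×ˢ (Set.univ : Set (Sp p)), ‖F' q.1 q.2‖ ≤ B :=
    hcpt.exists_bound_of_continuousOn (f := fun q : ℝ × Sp p => F' q.1 q.2) hF'c.continuousOn
  have hder := (hasDerivAt_integral_of_dominated_loc_of_deriv_le (μ := sg p) (F := F) (F' := F')
    (x₀ := (0:ℝ)) (s := Set.Icc (-1) 1) (bound := fun _ => B)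
    (Icc_mem_nhds (by norm_num) (by norm_num))
    (Filter.Eventually.of_forall fun θ => (hFc θ).aestronglyMeasurable)
    (cont_integrable (hFc 0))
    (by
      have : Continuous (F' 0) := hF'c.comp (by fun_prop : Continuous fun x : Sp p => ((0:ℝ), x))
      exact this.aestronglyMeasurable)
    (Filter.Eventually.of_forall fun x θ hθ => hB (θ, x) ⟨hθ, Set.mem_univ _⟩)
    (integrable_const _)
    (Filter.Eventually.of_forall fun x θ _ => by
      have hs := Real.hasDerivAt_sin θ
      have hc := Real.hasDerivAt_cos θ
      have h1 := (((((hc.const_mul ⟪e, (x : Eu p)⟫).add (hs.const_mul ⟪m, (x : Eu p)⟫)).sub_const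
        ⟪e, (x : Eu p)⟫).mul_const ⟪e, y⟫).const_add ⟪y, (x : Eu p)⟫)
      have h2 := (hc.const_mul ⟪m, (x : Eu p)⟫).sub (hs.const_mul ⟪e, (x : Eu p)⟫)
      have h3 := (hg (⟪m, (x : Eu p)⟫ * Real.cos θ - ⟪e, (x : Eu p)⟫ * Real.sin θ)).comp θ h2
      exact h1.mul h3)).2
  have hz : ∫ x, F' 0 x ∂(sg p) = 0 := by
    have : (fun θ => ∫ x, F θ x ∂(sg p)) = fun _ => ∫ x, F 0 x ∂(sg p) := funext hconst
    rw [this] at hder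
    exact hder.unique (hasDerivAt_const _ _)
  have h4 : ∀ x : Sp p, F' 0 x = ⟪e, y⟫ * (⟪m, (x : Eu p)⟫ * g ⟪m, (x : Eu p)⟫)
      - ⟪e, (x : Eu p)⟫ * ⟪y, (x : Eu p)⟫ * g' ⟪m, (x : Eu p)⟫ := by
    intro x
    simp [F']
    ring
  simp only [h4] at hz
  rw [integral_sub (cont_integrable (by fun_prop)) (cont_integrable (by fun_prop)),
    integral_const_mul] at hz
  linarith

lemma stein {p : ℕ} (m e y : Eu p) (hm : ‖m‖ = 1) (hme : ⟪m, e⟫ = 0)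
    (hmy : ⟪m, y⟫ = 0) (g g' : ℝ → ℝ) (hg : ∀ t, HasDerivAt g (g' t) t) (hg' : Continuous g') :
    ∫ x : Sp p, ⟪e, (x : Eu p)⟫ * ⟪y, (x : Eu p)⟫ * g' ⟪m, (x : Eu p)⟫ ∂(sg p)
      = ⟪e, y⟫ * ∫ x : Sp p, ⟪m, (x : Eu p)⟫ * g ⟪m, (x : Eu p)⟫ ∂(sg p) := by
  by_cases h : e = 0
  · simp [h]
  have hn : ‖e‖ ≠ 0 := norm_ne_zero_iff.2 h
  have := stein_unit m (‖e‖⁻¹ • e) y hm (by rw [norm_smul]; simp [hn])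
    (by rw [inner_smul_right, hme, mul_zero]) hmy g g' hg hg'
  simp only [inner_smul_left, conj_trivial, mul_assoc] at this
  rw [integral_const_mul] at this
  have := mul_left_cancel₀ (inv_ne_zero hn) this
  simpa only [mul_assoc] using this

lemma stein_sum {p : ℕ} (m : Eu p) (hm : ‖m‖ = 1)
    (g g' : ℝ → ℝ) (hg : ∀ t, HasDerivAt g (g' t) t) (hg' : Continuous g') :
    ((p : ℝ) - 1) * ∫ x : Sp p, ⟪m, (x : Eu p)⟫ * g ⟪m, (x : Eu p)⟫ ∂(sg p)
      = ∫ x : Sp p, (1 - ⟪m, (x : Eu p)⟫ ^ 2) * g' ⟪m, (x : Eu p)⟫ ∂(sg p) := by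
  have hmm : ⟪m, m⟫ = 1 := by rw [real_inner_self_eq_norm_sq, hm]; norm_num
  let E : Fin p → Eu p := fun i => EuclideanSpace.single i (1:ℝ) - (m i) • m
  have hEx : ∀ i (x : Eu p), ⟪E i, x⟫ = x i - m i * ⟪m, x⟫ := by
    intro i x
    simp [E, inner_sub_left, inner_smul_left, EuclideanSpace.inner_single_left]
  have hmE : ∀ i, ⟪m, E i⟫ = 0 := by
    intro i
    rw [real_inner_comm, hEx, hmm]; ring
  have hsq : ∀ x : Eu p, ∑ i, x i ^ 2 = ‖x‖ ^ 2 := by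
    intro x; rw [EuclideanSpace.real_norm_sq_eq]
  have hin : ∀ x : Eu p, ∑ i, m i * x i = ⟪m, x⟫ := by
    intro x
    rw [PiLp.inner_apply]
    exact Finset.sum_congr rfl fun i _ => by simp [mul_comm]
  have hEE : ∑ i, ⟪E i, E i⟫ = (p : ℝ) - 1 := by
    have : ∀ i, ⟪E i, E i⟫ = 1 - m i ^ 2 := by
      intro i
      rw [hEx, hmE]
      simp [E]; ring
    simp only [this]
    rw [Finset.sum_sub_distrib, hsq, hm]; simp
  have hpt : ∀ x : Sp p, (1 - ⟪m, (x : Eu p)⟫ ^ 2) * g' ⟪m, (x : Eu p)⟫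
      = ∑ i, ⟪E i, (x : Eu p)⟫ * ⟪E i, (x : Eu p)⟫ * g' ⟪m, (x : Eu p)⟫ := by
    intro x
    rw [← Finset.sum_mul]
    congr 1
    have hx : ‖(x : Eu p)‖ = 1 := by simp
    have : ∀ i, ⟪E i, (x : Eu p)⟫ * ⟪E i, (x : Eu p)⟫ = (x : Eu p) i ^ 2
        - 2 * ⟪m, (x : Eu p)⟫ * (m i * (x : Eu p) i) + ⟪m, (x : Eu p)⟫ ^ 2 * m i ^ 2 := by
      intro i; rw [hEx]; ring
    simp only [this]
    rw [Finset.sum_add_distrib, Finset.sum_sub_distrib, ← Finset.mul_sum, ← Finset.mul_sum,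
      hsq, hsq, hin, hm, hx]
    ring
  simp only [hpt]
  rw [integral_finsetSum _ (fun i _ => cont_integrable (by fun_prop)), ← hEE, Finset.sum_mul]
  exact Finset.sum_congr rfl fun i _ => (stein m (E i) (E i) hm (hmE i) (hmE i) g g' hg hg').symm

noncomputable def Mom {p : ℕ} (k : ℝ) (m : Eu p) (j : ℕ) : ℝ :=
  ∫ x : Sp p, ⟪m, (x : Eu p)⟫ ^ j * Real.exp (k * ⟪m, (x : Eu p)⟫) ∂(sg p)

lemma hexp (k t : ℝ) : HasDerivAt (fun t => Real.exp (k * t)) (k * Real.exp (k * t)) t := by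
  have := ((hasDerivAt_id t).const_mul k).exp
  simpa [mul_comm] using this

lemma mom_int {p : ℕ} (k : ℝ) (m : Eu p) (j : ℕ) : Integrable (fun x : Sp p =>
    ⟪m, (x : Eu p)⟫ ^ j * Real.exp (k * ⟪m, (x : Eu p)⟫)) (sg p) :=
  cont_integrable (by fun_prop)

lemma mom_rec0 {p : ℕ} (k : ℝ) (m : Eu p) (hm : ‖m‖ = 1) :
    ((p : ℝ) - 1) * Mom k m 1 = k * (Mom k m 0 - Mom k m 2) := by
  have h := stein_sum m hm (fun t => Real.exp (k * t)) (fun t => k * Real.exp (k * t))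
    (hexp k) (by fun_prop)
  have e1 : Mom k m 1 = ∫ x : Sp p, ⟪m, (x : Eu p)⟫ * Real.exp (k * ⟪m, (x : Eu p)⟫) ∂(sg p) := by
    simp [Mom]
  rw [e1, h, Mom, Mom, ← integral_sub (mom_int k m 0) (mom_int k m 2), ← integral_const_mul]
  congr 1; ext x; ring

lemma mom_rec {p : ℕ} (k : ℝ) (m : Eu p) (hm : ‖m‖ = 1) (j : ℕ) :
    ((p : ℝ) - 1) * Mom k m (j + 2) = (j + 1) * (Mom k m j - Mom k m (j + 2))
      + k * (Mom k m (j + 1) - Mom k m (j + 3)) := by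
  have h := stein_sum m hm (fun t => t ^ (j + 1) * Real.exp (k * t))
    (fun t => ((j + 1 : ℝ) * t ^ j) * Real.exp (k * t) + t ^ (j + 1) * (k * Real.exp (k * t)))
    (fun t => by
      have := (hasDerivAt_pow (j + 1) t).mul (hexp k t)
      exact this.congr_deriv (by simp)) (by fun_prop)
  have e1 : Mom k m (j + 2) = ∫ x : Sp p, ⟪m, (x : Eu p)⟫ *
      (⟪m, (x : Eu p)⟫ ^ (j + 1) * Real.exp (k * ⟪m, (x : Eu p)⟫)) ∂(sg p) := by
    rw [Mom]; congr 1; ext x; ring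
  have i1 := mom_int (p := p) k m
  have e2 : (j + 1) * (Mom k m j - Mom k m (j + 2)) + k * (Mom k m (j + 1) - Mom k m (j + 3))
      = ∫ x : Sp p, (1 - ⟪m, (x : Eu p)⟫ ^ 2) * (((j + 1 : ℝ) * ⟪m, (x : Eu p)⟫ ^ j) *
        Real.exp (k * ⟪m, (x : Eu p)⟫) + ⟪m, (x : Eu p)⟫ ^ (j + 1) *
          (k * Real.exp (k * ⟪m, (x : Eu p)⟫))) ∂(sg p) := by
    rw [Mom, Mom, Mom, Mom, ← integral_sub (i1 j) (i1 (j + 2)),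
      ← integral_sub (i1 (j + 1)) (i1 (j + 3)), ← integral_const_mul, ← integral_const_mul,
      ← integral_add]
    · congr 1; ext x; ring
    · exact cont_integrable (by fun_prop)
    · exact cont_integrable (by fun_prop)
  rw [e2, e1]
  exact h

lemma mom_nonneg2 {p : ℕ} (k : ℝ) (m : Eu p) : 0 ≤ Mom k m 0 - 2 * Mom k m 2 + Mom k m 4 := by
  have i1 := mom_int (p := p) k m
  rw [Mom, Mom, Mom, ← integral_const_mul, ← integral_sub (i1 0) ((i1 2).const_mul _),
    ← integral_add (cont_integrable (by fun_prop)) (i1 4)]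
  apply integral_nonneg
  intro x
  have : 0 ≤ (1 - ⟪m, (x : Eu p)⟫ ^ 2) ^ 2 * Real.exp (k * ⟪m, (x : Eu p)⟫) := by positivity
  dsimp only [Pi.zero_apply]
  nlinarith [this]

lemma mom_nonneg3 {p : ℕ} (k : ℝ) (m : Eu p) (hm : ‖m‖ = 1) :
    0 ≤ (Mom k m 0 - 3 * Mom k m 2) + (3 * Mom k m 4 - Mom k m 6) := by
  have i1 := mom_int (p := p) k m
  rw [Mom, Mom, Mom, Mom, ← integral_const_mul, ← integral_const_mul,
    ← integral_sub (i1 0) ((i1 2).const_mul _), ← integral_sub ((i1 4).const_mul _) (i1 6),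
    ← integral_add (cont_integrable (by fun_prop)) (cont_integrable (by fun_prop))]
  apply integral_nonneg
  intro x
  have hx : ‖(x : Eu p)‖ = 1 := by simp
  have h1 : |⟪m, (x : Eu p)⟫| ≤ 1 := by
    have := abs_real_inner_le_norm m (x : Eu p)
    rwa [hm, hx, one_mul] at this
  have h2 : 0 ≤ 1 - ⟪m, (x : Eu p)⟫ ^ 2 := by
    have := (sq_le_one_iff_abs_le_one _).2 h1
    linarith
  have : 0 ≤ (1 - ⟪m, (x : Eu p)⟫ ^ 2) ^ 3 * Real.exp (k * ⟪m, (x : Eu p)⟫) := by positivity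
  dsimp only [Pi.zero_apply]
  nlinarith [this]

lemma tensor {p : ℕ} (hp : 2 ≤ p) (k : ℝ) (hk : 0 < k) (m : Eu p) (hm : ‖m‖ = 1) :
    ∃ C D : ℝ, 0 ≤ C ∧ 0 ≤ D ∧ ∀ u v w : Eu p,
      ∫ x : Sp p, ⟪u, (x : Eu p)⟫ * ⟪v, (x : Eu p)⟫ * ⟪w, (x : Eu p)⟫ *
        Real.exp (k * ⟪m, (x : Eu p)⟫) ∂(sg p)
      = C * (⟪u, v⟫ * ⟪m, w⟫ + ⟪u, w⟫ * ⟪m, v⟫ + ⟪v, w⟫ * ⟪m, u⟫)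
        + D * (⟪m, u⟫ * ⟪m, v⟫ * ⟪m, w⟫) := by
  have hmm : ⟪m, m⟫ = 1 := by rw [real_inner_self_eq_norm_sq, hm]; norm_num
  have hp1 : (2:ℝ) ≤ p := by exact_mod_cast hp
  let g : ℝ → ℝ := fun t => (t / k - 1 / k ^ 2) * Real.exp (k * t)
  let g' : ℝ → ℝ := fun t => t * Real.exp (k * t)
  have hg : ∀ t, HasDerivAt g (g' t) t := by
    intro t
    have := (((hasDerivAt_id t).div_const k).sub_const (1 / k ^ 2)).mul (hexp k t)
    refine this.congr_deriv ?_
    simp only [g', id]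
    field_simp
    ring
  have hg' : Continuous g' := by fun_prop
  obtain ⟨C, hC⟩ : ∃ C, C = ∫ x : Sp p, ⟪m, (x : Eu p)⟫ * g ⟪m, (x : Eu p)⟫ ∂(sg p) := ⟨_, rfl⟩
  have hst := fun e y h1 h2 => stein (p := p) m e y hm h1 h2 g g' hg hg'
  have hss := stein_sum m hm g g' hg hg'
  rw [← hC] at hss
  have i1 := mom_int (p := p) k m
  have hC1 : ((p : ℝ) - 1) * C = Mom k m 1 - Mom k m 3 := by
    rw [hss, Mom, Mom, ← integral_sub (i1 1) (i1 3)]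
    congr 1; ext x; simp only [g']; ring
  have r0 := mom_rec0 k m hm
  have r1 := mom_rec k m hm 0
  have r2 := mom_rec k m hm 1
  have r3 := mom_rec k m hm 2
  have r4 := mom_rec k m hm 3
  norm_num at r1 r2 r3 r4
  have n2 := mom_nonneg2 k m
  have n3 := mom_nonneg3 k m hm
  have a1 : ((p : ℝ) + 1) * (Mom k m 1 - Mom k m 3)
      = k * (Mom k m 0 - 2 * Mom k m 2 + Mom k m 4) := by
    linear_combination r0 - r2
  have a2 : ((p : ℝ) + 3) * (Mom k m 1 - 2 * Mom k m 3 + Mom k m 5)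
      = k * ((Mom k m 0 - 3 * Mom k m 2) + (3 * Mom k m 4 - Mom k m 6)) := by
    linear_combination r0 - 2 * r2 + r4
  have a3 : ((p : ℝ) + 1) * (Mom k m 2 - Mom k m 4) - (Mom k m 0 - 2 * Mom k m 2 + Mom k m 4)
      = k * (Mom k m 1 - 2 * Mom k m 3 + Mom k m 5) := by
    linear_combination r1 - r3
  have hD : ((p : ℝ) + 1) * (((p : ℝ) - 1) * (Mom k m 3 - 3 * C))
      = k * (k * (Mom k m 1 - 2 * Mom k m 3 + Mom k m 5)) := by
    linear_combination ((p : ℝ) + 1) * r2 + k * a3 - 3 * ((p : ℝ) + 1) * hC1 - a1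
  have hX : 0 ≤ Mom k m 1 - 2 * Mom k m 3 + Mom k m 5 := by
    refine (mul_nonneg_iff_of_pos_left (by linarith : (0:ℝ) < (p : ℝ) + 3)).1 ?_
    rw [a2]; positivity
  refine ⟨C, Mom k m 3 - 3 * C, ?_, ?_, ?_⟩
  · refine (mul_nonneg_iff_of_pos_left (by linarith : (0:ℝ) < (p : ℝ) - 1)).1 ?_
    rw [hC1]
    refine (mul_nonneg_iff_of_pos_left (by linarith : (0:ℝ) < (p : ℝ) + 1)).1 ?_
    rw [a1]; positivity
  · refine (mul_nonneg_iff_of_pos_left (by linarith : (0:ℝ) < (p : ℝ) - 1)).1 ?_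
    refine (mul_nonneg_iff_of_pos_left (by linarith : (0:ℝ) < (p : ℝ) + 1)).1 ?_
    rw [hD]; positivity
  intro u v w
  obtain ⟨L, hL⟩ := exists_refl m hm
  have hinv := sphere_invariant L (fun x => ⟪u, x⟫ * ⟪v, x⟫ * ⟪w, x⟫ * Real.exp (k * ⟪m, x⟫))
    (by fun_prop)
  have hLc : Continuous (fun x : Sp p => L x) := L.continuous.comp continuous_subtype_val
  have perp : ∀ z : Eu p, ⟪m, z - ⟪m, z⟫ • m⟫ = 0 := by
    intro z; rw [inner_sub_right, inner_smul_right, hmm]; ring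
  have hpp : ∀ y z : Eu p, ⟪y - ⟪m, y⟫ • m, z - ⟪m, z⟫ • m⟫ = ⟪y, z⟫ - ⟪m, y⟫ * ⟪m, z⟫ := by
    intro y z
    simp only [inner_sub_right, inner_sub_left, inner_smul_left, inner_smul_right, hmm,
      conj_trivial, real_inner_comm m y]
    ring
  have q := fun y z : Eu p => hst (y - ⟪m, y⟫ • m) (z - ⟪m, z⟫ • m) (perp y) (perp z)
  simp only [hpp, ← hC] at q
  have iq : ∀ y z : Eu p, Integrable (fun x : Sp p => ⟪y - ⟪m, y⟫ • m, (x : Eu p)⟫ *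
      ⟪z - ⟪m, z⟫ • m, (x : Eu p)⟫ * g' ⟪m, (x : Eu p)⟫) (sg p) := by
    intro y z
    exact cont_integrable (by fun_prop)
  have key : ∫ x : Sp p, (⟪u, L x⟫ * ⟪v, L x⟫ * ⟪w, L x⟫ * Real.exp (k * ⟪m, L x⟫)
      + ⟪u, (x : Eu p)⟫ * ⟪v, (x : Eu p)⟫ * ⟪w, (x : Eu p)⟫ * Real.exp (k * ⟪m, (x : Eu p)⟫)) ∂(sg p)
      = (2 * (⟪m, u⟫ * ⟪m, v⟫ * ⟪m, w⟫)) * Mom k m 3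
        + 2 * ⟪m, u⟫ * ((⟪v, w⟫ - ⟪m, v⟫ * ⟪m, w⟫) * C)
        + 2 * ⟪m, v⟫ * ((⟪u, w⟫ - ⟪m, u⟫ * ⟪m, w⟫) * C)
        + 2 * ⟪m, w⟫ * ((⟪u, v⟫ - ⟪m, u⟫ * ⟪m, v⟫) * C) := by
    rw [← q v w, ← q u w, ← q u v, Mom]
    simp only [← integral_const_mul]
    have j3 := (i1 3).const_mul (2 * (⟪m, u⟫ * ⟪m, v⟫ * ⟪m, w⟫))
    have ja := (iq v w).const_mul (2 * ⟪m, u⟫)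
    have jb := (iq u w).const_mul (2 * ⟪m, v⟫)
    have jc := (iq u v).const_mul (2 * ⟪m, w⟫)
    rw [← integral_add j3 ja, ← integral_add (cont_integrable (by fun_prop)) jb,
      ← integral_add (cont_integrable (by fun_prop)) jc]
    congr 1; ext x
    simp only [hL, g', inner_sub_left, inner_sub_right, inner_smul_left, inner_smul_right, hmm,
      conj_trivial, real_inner_comm m u, real_inner_comm m v, real_inner_comm m w]
    have : k * (2 * ⟪m, (x : Eu p)⟫ * 1 - ⟪m, (x : Eu p)⟫) = k * ⟪m, (x : Eu p)⟫ := by ring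
    rw [this]
    ring
  rw [integral_add (cont_integrable (by fun_prop)) (cont_integrable (by fun_prop)), hinv] at key
  linear_combination key / 2

lemma coord {p : ℕ} (F : Sp p → ℝ) (hF : Continuous F) (l : Fin p) :
    (∫ x : Sp p, F x • (x : Eu p) ∂(sg p)) l = ∫ x : Sp p, F x * (x : Eu p) l ∂(sg p) := by
  have hc : Continuous (fun x : Sp p => F x • (x : Eu p)) := by fun_prop
  have hi : Integrable (fun x : Sp p => F x • (x : Eu p)) (sg p) :=
    hc.integrable_of_hasCompactSupport (HasCompactSupport.of_compactSpace _)
  have := (EuclideanSpace.proj (𝕜 := ℝ) l).integral_comp_comm hi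
  simpa using this.symm

lemma first_moment {p : ℕ} (k : ℝ) (m : Eu p) (hm : ‖m‖ = 1) :
    ∫ x : Sp p, Real.exp (k * ⟪m, (x : Eu p)⟫) • (x : Eu p) ∂(sg p) = (Mom k m 1) • m := by
  have hmm : ⟪m, m⟫ = 1 := by rw [real_inner_self_eq_norm_sq, hm]; norm_num
  ext l
  rw [coord _ (by fun_prop)]
  obtain ⟨L, hL⟩ := exists_refl m hm
  have hLc : Continuous (fun x : Sp p => L x) := L.continuous.comp continuous_subtype_val
  have hinv := sphere_invariant L (fun x => Real.exp (k * ⟪m, x⟫) * x l) (by fun_prop)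
  have key : ∫ x : Sp p, (Real.exp (k * ⟪m, L x⟫) * (L x) l +
      Real.exp (k * ⟪m, (x : Eu p)⟫) * (x : Eu p) l) ∂(sg p) = (2 * m l) * Mom k m 1 := by
    rw [Mom, ← integral_const_mul]
    congr 1; ext x
    simp only [hL, inner_sub_right, inner_smul_right, hmm]
    have : k * (2 * ⟪m, (x : Eu p)⟫ * 1 - ⟪m, (x : Eu p)⟫) = k * ⟪m, (x : Eu p)⟫ := by ring
    rw [this]
    simp
    ring
  rw [integral_add (cont_integrable (by fun_prop)) (cont_integrable (by fun_prop)), hinv] at key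
  simp only [PiLp.smul_apply, smul_eq_mul]
  linear_combination key / 2

lemma quad_expand {p : ℕ} (W : Matrix (Fin p) (Fin p) ℝ) (x : Eu p) :
    ⟪x, Matrix.toEuclideanLin W x⟫ = ∑ i, ∑ j, W i j * (x i * x j) := by
  rw [PiLp.inner_apply]
  refine Finset.sum_congr rfl fun i _ => ?_
  simp only [Matrix.toLpLin_apply, Matrix.mulVec, dotProduct, RCLike.inner_apply,
    conj_trivial, Finset.sum_mul]
  exact Finset.sum_congr rfl fun j _ => by ring

lemma lin_cont {p : ℕ} (W : Matrix (Fin p) (Fin p) ℝ) :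
    Continuous (fun x : Sp p => ⟪(x : Eu p), Matrix.toEuclideanLin W (x : Eu p)⟫) := by
  simp only [quad_expand]
  fun_prop

lemma second {p : ℕ} (hp : 2 ≤ p) (k : ℝ) (hk : 0 < k) (m : Eu p) (hm : ‖m‖ = 1) :
    ∃ C D : ℝ, 0 ≤ C ∧ 0 ≤ D ∧ ∀ W : Matrix (Fin p) (Fin p) ℝ, W.IsSymm →
      ∫ x : Sp p, (⟪(x : Eu p), Matrix.toEuclideanLin W (x : Eu p)⟫ *
          Real.exp (k * ⟪m, (x : Eu p)⟫)) • (x : Eu p) ∂(sg p)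
        = (2 * C) • Matrix.toEuclideanLin W m
          + (C * W.trace + D * ⟪m, Matrix.toEuclideanLin W m⟫) • m := by
  obtain ⟨C, D, hC, hD, hT⟩ := tensor hp k hk m hm
  refine ⟨C, D, hC, hD, fun W hW => ?_⟩
  have hWc := lin_cont W
  ext l
  rw [coord _ (by fun_prop)]
  have hT' : ∀ i j, ∫ x : Sp p, (x : Eu p) i * (x : Eu p) j * (x : Eu p) l *
      Real.exp (k * ⟪m, (x : Eu p)⟫) ∂(sg p)
      = C * ((if i = j then 1 else 0) * m l + (if i = l then 1 else 0) * m j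
        + (if j = l then 1 else 0) * m i) + D * (m i * m j * m l) := by
    intro i j
    have := hT (EuclideanSpace.single i 1) (EuclideanSpace.single j 1) (EuclideanSpace.single l 1)
    simpa [EuclideanSpace.inner_single_left, EuclideanSpace.inner_single_right,
      Pi.single_apply, eq_comm] using this
  have hpt : ∀ x : Sp p, ⟪(x : Eu p), Matrix.toEuclideanLin W (x : Eu p)⟫ *
      Real.exp (k * ⟪m, (x : Eu p)⟫) * (x : Eu p) l = ∑ i, ∑ j, W i j * ((x : Eu p) i *
        (x : Eu p) j * (x : Eu p) l * Real.exp (k * ⟪m, (x : Eu p)⟫)) := by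
    intro x
    rw [quad_expand, Finset.sum_mul, Finset.sum_mul]
    refine Finset.sum_congr rfl fun i _ => ?_
    rw [Finset.sum_mul, Finset.sum_mul]
    exact Finset.sum_congr rfl fun j _ => by ring
  simp only [hpt]
  rw [integral_finsetSum _ (fun i _ => cont_integrable (by fun_prop))]
  have : ∀ i, ∫ x : Sp p, ∑ j, W i j * ((x : Eu p) i *
        (x : Eu p) j * (x : Eu p) l * Real.exp (k * ⟪m, (x : Eu p)⟫)) ∂(sg p)
      = C * (W i i * m l) + C * ((if i = l then ∑ j, W i j * m j else 0))
        + C * (W i l * m i) + D * m l * ∑ j, W i j * (m i * m j) := by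
    intro i
    rw [integral_finsetSum _ (fun i _ => cont_integrable (by fun_prop))]
    simp only [integral_const_mul, hT']
    have e : ∀ j, W i j * (C * ((if i = j then 1 else 0) * m l + (if i = l then 1 else 0) * m j
        + (if j = l then 1 else 0) * m i) + D * (m i * m j * m l))
        = (if i = j then C * (W i j * m l) else 0) + C * (if i = l then W i j * m j else 0)
        + (if j = l then C * (W i j * m i) else 0) + D * m l * (W i j * (m i * m j)) := by
      intro j
      split_ifs <;> ring
    simp only [e, Finset.sum_add_distrib, ← Finset.mul_sum]
    congr 2
    · congr 1
      · simp
      · split_ifs <;> simp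
    · simp
  simp only [this, Finset.sum_add_distrib, ← Finset.mul_sum, ← quad_expand]
  have hsym : ∑ i, W i l * m i = ∑ j, W l j * m j :=
    Finset.sum_congr rfl fun i _ => by rw [hW.apply]
  rw [hsym, ← Finset.sum_mul]
  simp [Matrix.trace, Matrix.mulVec, dotProduct]
  ring

/-- posterior-mean formula: For the surface measure σ on S^{p−1} ⊂ ℝ^p
(p ≥ 2), μ ∈ S^{p−1}, k > 0, Z = ∫ e^{k⟨μ,x⟩} dσ, there exist c, d ≥ 0 (independent of W)
such that for every symmetric p × p real matrix W,
(1/Z) ∫ (xᵀWx) x e^{k⟨μ,x⟩} dσ = 2c·Wμ + (c·Tr W + d·μᵀWμ)·μ; consequently the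
(unnormalized) Bayesian posterior mean ∫ (1 + xᵀWx) x e^{k⟨μ,x⟩} dσ is a linear
combination α μ + β Wμ with β ≥ 0. -/
theorem stmt14 (p : ℕ) (hp : 2 ≤ p) (k : ℝ) (hk : 0 < k)
    (μ : EuclideanSpace ℝ (Fin p)) (hμ : ‖μ‖ = 1)
    (Z : ℝ)
    (hZ : Z = ∫ x : Metric.sphere (0 : EuclideanSpace ℝ (Fin p)) 1,
        Real.exp (k * ⟪μ, (x : EuclideanSpace ℝ (Fin p))⟫)
        ∂((volume : Measure (EuclideanSpace ℝ (Fin p))).toSphere)) :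
    ∃ c d : ℝ, 0 ≤ c ∧ 0 ≤ d ∧
      ∀ W : Matrix (Fin p) (Fin p) ℝ, W.IsSymm →
        ((1 / Z) • (∫ x : Metric.sphere (0 : EuclideanSpace ℝ (Fin p)) 1,
            (⟪(x : EuclideanSpace ℝ (Fin p)),
                Matrix.toEuclideanLin W (x : EuclideanSpace ℝ (Fin p))⟫ *
              Real.exp (k * ⟪μ, (x : EuclideanSpace ℝ (Fin p))⟫)) •
              (x : EuclideanSpace ℝ (Fin p))
            ∂((volume : Measure (EuclideanSpace ℝ (Fin p))).toSphere))
          = (2 * c) • Matrix.toEuclideanLin W μ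
            + (c * W.trace + d * ⟪μ, Matrix.toEuclideanLin W μ⟫) • μ)
        ∧ ∃ α β : ℝ, 0 ≤ β ∧
            (∫ x : Metric.sphere (0 : EuclideanSpace ℝ (Fin p)) 1,
              ((1 + ⟪(x : EuclideanSpace ℝ (Fin p)),
                  Matrix.toEuclideanLin W (x : EuclideanSpace ℝ (Fin p))⟫) *
                Real.exp (k * ⟪μ, (x : EuclideanSpace ℝ (Fin p))⟫)) •
                (x : EuclideanSpace ℝ (Fin p))
              ∂((volume : Measure (EuclideanSpace ℝ (Fin p))).toSphere))
            = α • μ + β • Matrix.toEuclideanLin W μ := by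
  obtain ⟨C, D, hC, hD, h⟩ := second hp k hk μ hμ
  have hZ0 : 0 ≤ 1 / Z := by
    rw [hZ]
    exact one_div_nonneg.2 (integral_nonneg fun x => (Real.exp_pos _).le)
  refine ⟨1 / Z * C, 1 / Z * D, mul_nonneg hZ0 hC, mul_nonneg hZ0 hD, fun W hW => ⟨?_, ?_⟩⟩
  · rw [h W hW]
    module
  · refine ⟨Mom k μ 1 + (C * W.trace + D * ⟪μ, Matrix.toEuclideanLin W μ⟫), 2 * C,
      by positivity, ?_⟩
    have hWc := lin_cont W
    simp only [add_mul, one_mul, add_smul]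
    rw [integral_add, h W hW]
    · have := first_moment k μ hμ
      rw [this]
      module
    · exact Continuous.integrable_of_hasCompactSupport (by fun_prop)
        (HasCompactSupport.of_compactSpace _)
    · exact Continuous.integrable_of_hasCompactSupport (by fun_prop)
        (HasCompactSupport.of_compactSpace _)
end

section
/- (Variance-type moment inequality, equivalent to A_p(k)² ≥ B.) Let σ be the surface measure on the unit sphere S^{p−1} ⊂ ℝ^p (p ≥ 2), μ ∈ S^{p−1}, k > 0, and define m_j = (∫ ⟨μ,x⟩^j e^{k⟨μ,x⟩} dσ)/(∫ e^{k⟨μ,x⟩} dσ) for j = 1, 2. Then m_1² ≥ m_2 − m_1/k; equivalently, with A = m_1 and B = m_2 − m_1/k (so that A = A_p(k) = I_{p/2}(k)/I_{p/2−1}(k) and B = I_{p/2+1}(k)/I_{p/2−1}(k)), one has A² ≥ B. -/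
open MeasureTheory RealInnerProductSpace

section helpers
open Set Pointwise

variable {p : ℕ}

local notation "EE" => EuclideanSpace ℝ (Fin p)
local notation "SS" => Metric.sphere (0 : EuclideanSpace ℝ (Fin p)) 1
local notation "sg" => Measure.toSphere (volume : Measure (EuclideanSpace ℝ (Fin p)))

lemma sphere_inv (R : EE ≃ₗᵢ[ℝ] EE) (g : EE → ℝ) :
    ∫ x : SS, g (R x) ∂sg = ∫ x : SS, g x ∂sg := by
  let φ : SS ≃ₜ SS :=
    { toFun := fun x => ⟨R x, by simp⟩
      invFun := fun x => ⟨R.symm x, by simp⟩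
      left_inv := fun x => by ext; simp
      right_inv := fun x => by ext; simp
      continuous_toFun := by fun_prop
      continuous_invFun := by fun_prop }
  have hφ : MeasurePreserving φ sg sg := by
    refine ⟨φ.continuous.measurable, ?_⟩
    ext s hs
    rw [Measure.map_apply φ.continuous.measurable hs, Measure.toSphere_apply' _ hs,
      Measure.toSphere_apply' _ (φ.continuous.measurable hs)]
    congr 1
    have : Ioo (0:ℝ) 1 • ((↑) '' (φ ⁻¹' s) : Set EE) = R ⁻¹' (Ioo (0:ℝ) 1 • ((↑) '' s : Set EE)) := by
      ext x
      simp only [Set.mem_smul, Set.mem_preimage, Set.mem_image]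
      constructor
      · rintro ⟨r, hr, _, ⟨y, hy, rfl⟩, rfl⟩
        exact ⟨r, hr, _, ⟨φ y, hy, rfl⟩, by simp [φ]⟩
      · rintro ⟨r, hr, _, ⟨y, hy, rfl⟩, h⟩
        refine ⟨r, hr, _, ⟨φ.symm y, by simpa using hy, rfl⟩, ?_⟩
        apply R.injective
        rw [← h]; simp [φ]
    rw [this]
    exact R.measurePreserving.measure_preimage_equiv (f := R.toMeasurableEquiv) _
  exact hφ.integral_comp' (f := φ.toMeasurableEquiv) (fun x => g x)

lemma sphere_int {g : SS → ℝ} (hg : Continuous g) : Integrable g sg :=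
  hg.integrable_of_hasCompactSupport (HasCompactSupport.of_compactSpace g)

lemma sphere_diff (F F' : ℝ → SS → ℝ) (hF : ∀ θ x, HasDerivAt (F · x) (F' θ x) θ)
    (hFc : ∀ θ, Continuous (F θ)) (hF'c : Continuous (fun q : ℝ × SS => F' q.1 q.2)) :
    HasDerivAt (fun θ => ∫ x, F θ x ∂sg) (∫ x, F' 0 x ∂sg) 0 := by
  obtain ⟨C, hC⟩ := ((isCompact_Icc (a := (-1:ℝ)) (b := 1)).prod
    (isCompact_univ (X := SS))).exists_bound_of_continuousOn hF'c.continuousOn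
  have hb : ∀ x : SS, ∀ θ ∈ Icc (-1:ℝ) 1, ‖F' θ x‖ ≤ C := fun x θ hθ =>
    hC (θ, x) (Set.mem_prod.2 ⟨hθ, mem_univ _⟩)
  have h0 : Continuous (F' 0) := hF'c.comp (by fun_prop : Continuous fun x : SS => ((0:ℝ), x))
  exact (hasDerivAt_integral_of_dominated_loc_of_deriv_le (μ := sg) (F := F) (F' := F')
    (x₀ := (0:ℝ)) (s := Icc (-1) 1) (bound := fun _ => C) (Icc_mem_nhds (by norm_num) (by norm_num))
    (Filter.Eventually.of_forall fun θ => (hFc θ).aestronglyMeasurable)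
    (sphere_int (hFc 0)) h0.aestronglyMeasurable
    (Filter.Eventually.of_forall hb)
    (integrable_const _)
    (Filter.Eventually.of_forall fun x θ _ => hF θ x)).2

lemma sphere_rot (μ e : EE) (hμ : ‖μ‖ = 1) (he : ‖e‖ = 1) (hμe : ⟪μ, e⟫ = 0)
    (f f' : ℝ → ℝ) (hf : ∀ t, HasDerivAt f (f' t) t) (hf' : Continuous f') :
    ∫ x : SS, (⟪μ, (x : EE)⟫ * f ⟪μ, (x : EE)⟫
      - ⟪e, (x : EE)⟫ ^ 2 * f' ⟪μ, (x : EE)⟫) ∂sg = 0 := by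
  have hfc : Continuous f := continuous_iff_continuousAt.2 fun t => (hf t).continuousAt
  let T : ℝ → SS → ℝ := fun θ x =>
    2 * (Real.cos θ * ⟪μ, (x : EE)⟫ + Real.sin θ * ⟪e, (x : EE)⟫) * Real.cos θ - ⟪μ, (x : EE)⟫
  let Y : ℝ → SS → ℝ := fun θ x =>
    2 * (Real.cos θ * ⟪μ, (x : EE)⟫ + Real.sin θ * ⟪e, (x : EE)⟫) * Real.sin θ - ⟪e, (x : EE)⟫
  let T' : ℝ → SS → ℝ := fun θ x =>
    2 * (-Real.sin θ * ⟪μ, (x : EE)⟫ + Real.cos θ * ⟪e, (x : EE)⟫) * Real.cos θ +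
    2 * (Real.cos θ * ⟪μ, (x : EE)⟫ + Real.sin θ * ⟪e, (x : EE)⟫) * (-Real.sin θ)
  let Y' : ℝ → SS → ℝ := fun θ x =>
    2 * (-Real.sin θ * ⟪μ, (x : EE)⟫ + Real.cos θ * ⟪e, (x : EE)⟫) * Real.sin θ +
    2 * (Real.cos θ * ⟪μ, (x : EE)⟫ + Real.sin θ * ⟪e, (x : EE)⟫) * Real.cos θ
  have hl : ∀ θ x, HasDerivAt (fun θ => 2 * (Real.cos θ * ⟪μ, (x : EE)⟫ + Real.sin θ * ⟪e, (x : EE)⟫))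
      (2 * (-Real.sin θ * ⟪μ, (x : EE)⟫ + Real.cos θ * ⟪e, (x : EE)⟫)) θ := fun θ x =>
    (((Real.hasDerivAt_cos θ).mul_const _).add ((Real.hasDerivAt_sin θ).mul_const _)).const_mul 2
  have hT : ∀ θ x, HasDerivAt (T · x) (T' θ x) θ := fun θ x =>
    ((hl θ x).mul (Real.hasDerivAt_cos θ)).sub_const _
  have hY : ∀ θ x, HasDerivAt (Y · x) (Y' θ x) θ := fun θ x =>
    ((hl θ x).mul (Real.hasDerivAt_sin θ)).sub_const _
  let F : ℝ → SS → ℝ := fun θ x => Y θ x * f (T θ x)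
  let F' : ℝ → SS → ℝ := fun θ x => Y' θ x * f (T θ x) + Y θ x * (f' (T θ x) * T' θ x)
  have hF : ∀ θ x, HasDerivAt (F · x) (F' θ x) θ := fun θ x =>
    (hY θ x).mul ((hf (T θ x)).comp θ (hT θ x))
  have hFc : ∀ θ, Continuous (F θ) := by intro θ; dsimp only [F, Y, T]; fun_prop
  have hF'c : Continuous (fun q : ℝ × SS => F' q.1 q.2) := by
    dsimp only [F', Y, T, Y', T']; fun_prop
  have hconst : ∀ θ, ∫ x, F θ x ∂sg = ∫ x : SS, ⟪e, (x : EE)⟫ * f ⟪μ, (x : EE)⟫ ∂sg := by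
    intro θ
    let v : EE := Real.cos θ • μ + Real.sin θ • e
    have heμ : ⟪e, μ⟫ = 0 := by rw [real_inner_comm]; exact hμe
    have hμμ : ⟪μ, μ⟫ = 1 := by rw [real_inner_self_eq_norm_sq, hμ]; norm_num
    have hee : ⟪e, e⟫ = 1 := by rw [real_inner_self_eq_norm_sq, he]; norm_num
    have hv : ‖v‖ ^ 2 = 1 := by
      rw [← real_inner_self_eq_norm_sq]
      simp only [v, inner_add_left, inner_add_right, real_inner_smul_left, real_inner_smul_right,
        hμe, heμ, hμμ, hee]
      nlinarith [Real.sin_sq_add_cos_sq θ]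
    rw [← sphere_inv (Submodule.reflection (ℝ ∙ v)) (fun x => ⟪e, x⟫ * f ⟪μ, x⟫)]
    congr 1
    ext x
    have hR : Submodule.reflection (ℝ ∙ v) (x : EE) = (2 * ⟪v, (x : EE)⟫) • v - x := by
      rw [Submodule.reflection_singleton_apply]
      simp [hv, two_mul, add_smul, two_smul]
    have h1 : ⟪v, (x : EE)⟫ = Real.cos θ * ⟪μ, (x : EE)⟫ + Real.sin θ * ⟪e, (x : EE)⟫ := by
      simp only [v, inner_add_left, real_inner_smul_left]
    have h2 : ⟪μ, v⟫ = Real.cos θ := by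
      simp only [v, inner_add_right, real_inner_smul_right, hμμ, hμe]; ring
    have h3 : ⟪e, v⟫ = Real.sin θ := by
      simp only [v, inner_add_right, real_inner_smul_right, hee, heμ]; ring
    simp only [hR, inner_sub_right, real_inner_smul_right, h1, h2, h3, F, T, Y]
  have hd := sphere_diff F F' hF hFc hF'c
  rw [funext hconst] at hd
  have h0 := hd.unique (hasDerivAt_const _ _)
  have h4 : ∀ x, F' 0 x = 2 * (⟪μ, (x : EE)⟫ * f ⟪μ, (x : EE)⟫
      - ⟪e, (x : EE)⟫ ^ 2 * f' ⟪μ, (x : EE)⟫) := by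
    intro x
    have : 2 * ⟪μ, (x : EE)⟫ - ⟪μ, (x : EE)⟫ = ⟪μ, (x : EE)⟫ := by ring
    simp [F', T, Y, T', Y', this]
    ring
  simp only [h4, integral_const_mul] at h0
  linarith

lemma sphere_ibp (hp : 2 ≤ p) (μ : EE) (hμ : ‖μ‖ = 1)
    (f f' : ℝ → ℝ) (hf : ∀ t, HasDerivAt f (f' t) t) (hf' : Continuous f') :
    ∫ x : SS, (((p:ℝ) - 1) * (⟪μ, (x : EE)⟫ * f ⟪μ, (x : EE)⟫)
      - (1 - ⟪μ, (x : EE)⟫ ^ 2) * f' ⟪μ, (x : EE)⟫) ∂sg = 0 := by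
  have hfc : Continuous f := continuous_iff_continuousAt.2 fun t => (hf t).continuousAt
  let i0 : Fin p := ⟨0, by omega⟩
  obtain ⟨b, hb⟩ := Orthonormal.exists_orthonormalBasis_extension_of_card_eq (𝕜 := ℝ) (E := EE)
    (ι := Fin p) (by simp) (v := fun _ => μ) (s := {i0}) (by
      refine ⟨fun i => by simpa using hμ, fun i j hij => absurd (Subsingleton.elim i j) hij⟩)
  have hb0 : b i0 = μ := hb i0 rfl
  have h1 : ∀ i ∈ Finset.univ.erase i0, ∫ x : SS, (⟪μ, (x : EE)⟫ * f ⟪μ, (x : EE)⟫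
      - ⟪b i, (x : EE)⟫ ^ 2 * f' ⟪μ, (x : EE)⟫) ∂sg = 0 := by
    intro i hi
    refine sphere_rot μ (b i) hμ (b.orthonormal.1 i) ?_ f f' hf hf'
    rw [← hb0]
    exact b.orthonormal.2 (Finset.ne_of_mem_erase hi).symm
  have h2 := Finset.sum_eq_zero h1
  rw [← integral_finsetSum _ (fun i _ => sphere_int (by fun_prop))] at h2
  rw [← h2]
  congr 1
  ext x
  have h3 := b.sum_sq_norm_inner_right (x : EE)
  rw [← Finset.add_sum_erase _ _ (Finset.mem_univ i0), hb0] at h3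
  simp only [Real.norm_eq_abs, sq_abs, norm_eq_of_mem_sphere, one_pow] at h3
  rw [Finset.sum_sub_distrib, ← Finset.sum_mul _ _ (f' _), Finset.sum_const,
    Finset.card_erase_of_mem (Finset.mem_univ _), Finset.card_univ, Fintype.card_fin,
    nsmul_eq_mul, Nat.cast_sub (by omega), eq_sub_of_add_eq' h3]
  push_cast
  ring

lemma cheb_nonneg (k : ℝ) (hk : 0 < k) (u c : ℝ) (hu : 0 ≤ u) (hc : 0 ≤ c) :
    0 ≤ (u ^ 2 - c ^ 2) * (u * Real.sinh (k * u) * Real.cosh (k * c)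
      - c * Real.sinh (k * c) * Real.cosh (k * u)) := by
  have key : ∀ a b : ℝ, 0 ≤ b → b ≤ a → b * Real.sinh (k * b) * Real.cosh (k * a) ≤
      a * Real.sinh (k * a) * Real.cosh (k * b) := by
    intro a b hb hab
    have h1 : 0 ≤ Real.sinh (k * a - k * b) :=
      Real.sinh_nonneg_iff.2 (by nlinarith)
    rw [Real.sinh_sub] at h1
    have h2 : 0 ≤ Real.sinh (k * a) * Real.cosh (k * b) :=
      mul_nonneg (Real.sinh_nonneg_iff.2 (mul_nonneg hk.le (hb.trans hab))) (Real.cosh_pos _).le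
    nlinarith [mul_nonneg hb h1, mul_nonneg (sub_nonneg.2 hab) h2]
  rcases le_total c u with h | h
  · exact mul_nonneg (by nlinarith) (sub_nonneg.2 (key u c hc h))
  · exact mul_nonneg_of_nonpos_of_nonpos (by nlinarith) (sub_nonpos.2 (key c u hu h))

lemma cheb_nonneg' (k : ℝ) (hk : 0 < k) (t c : ℝ) (hc : 0 ≤ c) :
    0 ≤ (t ^ 2 - c ^ 2) * (t * Real.sinh (k * t) * Real.cosh (k * c)
      - c * Real.sinh (k * c) * Real.cosh (k * t)) := by
  rcases le_total 0 t with h | h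
  · exact cheb_nonneg k hk t c h hc
  · have := cheb_nonneg k hk (-t) c (by linarith) hc
    simpa using this

/-- antipodal symmetrization -/
lemma sphere_symm (μ : EE) (g : ℝ → ℝ) (hg : Continuous g) :
    ∫ x : SS, (g ⟪μ, (x : EE)⟫ + g (-⟪μ, (x : EE)⟫)) ∂sg = 2 * ∫ x : SS, g ⟪μ, (x : EE)⟫ ∂sg := by
  rw [integral_add (sphere_int (by fun_prop)) (sphere_int (by fun_prop)), two_mul]
  congr 1
  rw [← sphere_inv (LinearIsometryEquiv.neg ℝ) (fun x => g ⟪μ, x⟫)]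
  simp

end helpers



/-- variance-type moment inequality, equivalent to A_p(k)² ≥ B:
For the surface measure σ on S^{p−1} ⊂ ℝ^p (p ≥ 2), μ ∈ S^{p−1}, k > 0, and
m_j = (∫ ⟨μ,x⟩^j e^{k⟨μ,x⟩} dσ)/(∫ e^{k⟨μ,x⟩} dσ), one has m_1² ≥ m_2 − m_1/k;
equivalently, with A = m_1 and B = m_2 − m_1/k, A² ≥ B. -/
theorem stmt16 (p : ℕ) (hp : 2 ≤ p) (k : ℝ) (hk : 0 < k)
    (μ : EuclideanSpace ℝ (Fin p)) (hμ : ‖μ‖ = 1)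
    (m1 m2 : ℝ)
    (hm1 : m1 = (∫ x : Metric.sphere (0 : EuclideanSpace ℝ (Fin p)) 1,
          ⟪μ, (x : EuclideanSpace ℝ (Fin p))⟫ ^ 1 *
            Real.exp (k * ⟪μ, (x : EuclideanSpace ℝ (Fin p))⟫)
          ∂((volume : Measure (EuclideanSpace ℝ (Fin p))).toSphere))
        / (∫ x : Metric.sphere (0 : EuclideanSpace ℝ (Fin p)) 1,
            Real.exp (k * ⟪μ, (x : EuclideanSpace ℝ (Fin p))⟫)
            ∂((volume : Measure (EuclideanSpace ℝ (Fin p))).toSphere)))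
    (hm2 : m2 = (∫ x : Metric.sphere (0 : EuclideanSpace ℝ (Fin p)) 1,
          ⟪μ, (x : EuclideanSpace ℝ (Fin p))⟫ ^ 2 *
            Real.exp (k * ⟪μ, (x : EuclideanSpace ℝ (Fin p))⟫)
          ∂((volume : Measure (EuclideanSpace ℝ (Fin p))).toSphere))
        / (∫ x : Metric.sphere (0 : EuclideanSpace ℝ (Fin p)) 1,
            Real.exp (k * ⟪μ, (x : EuclideanSpace ℝ (Fin p))⟫)
            ∂((volume : Measure (EuclideanSpace ℝ (Fin p))).toSphere))) :
    m1 ^ 2 ≥ m2 - m1 / k := by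
  have int : ∀ g : Metric.sphere (0 : EuclideanSpace ℝ (Fin p)) 1 → ℝ, Continuous g →
    Integrable g ((volume : Measure (EuclideanSpace ℝ (Fin p))).toSphere) := fun g hg => sphere_int hg
  have hsub : ∀ (a b c d : ℝ), ∫ x : Metric.sphere (0 : EuclideanSpace ℝ (Fin p)) 1,
      (a + b * ⟪μ, (x : EuclideanSpace ℝ (Fin p))⟫ ^ 1 + c * ⟪μ, (x : EuclideanSpace ℝ (Fin p))⟫ ^ 2
        + d * ⟪μ, (x : EuclideanSpace ℝ (Fin p))⟫ ^ 3) *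
            Real.exp (k * ⟪μ, (x : EuclideanSpace ℝ (Fin p))⟫)
          ∂((volume : Measure (EuclideanSpace ℝ (Fin p))).toSphere) =
      a * (∫ x : Metric.sphere (0 : EuclideanSpace ℝ (Fin p)) 1,
            Real.exp (k * ⟪μ, (x : EuclideanSpace ℝ (Fin p))⟫)
            ∂((volume : Measure (EuclideanSpace ℝ (Fin p))).toSphere)) +
      b * (∫ x : Metric.sphere (0 : EuclideanSpace ℝ (Fin p)) 1,
            ⟪μ, (x : EuclideanSpace ℝ (Fin p))⟫ ^ 1 * Real.exp (k * ⟪μ, (x : EuclideanSpace ℝ (Fin p))⟫)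
            ∂((volume : Measure (EuclideanSpace ℝ (Fin p))).toSphere)) +
      c * (∫ x : Metric.sphere (0 : EuclideanSpace ℝ (Fin p)) 1,
            ⟪μ, (x : EuclideanSpace ℝ (Fin p))⟫ ^ 2 * Real.exp (k * ⟪μ, (x : EuclideanSpace ℝ (Fin p))⟫)
            ∂((volume : Measure (EuclideanSpace ℝ (Fin p))).toSphere)) +
      d * (∫ x : Metric.sphere (0 : EuclideanSpace ℝ (Fin p)) 1,
            ⟪μ, (x : EuclideanSpace ℝ (Fin p))⟫ ^ 3 * Real.exp (k * ⟪μ, (x : EuclideanSpace ℝ (Fin p))⟫)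
            ∂((volume : Measure (EuclideanSpace ℝ (Fin p))).toSphere)) := by
    intro a b c d
    simp only [← integral_const_mul]
    rw [← integral_add (int _ (by fun_prop)) (int _ (by fun_prop)),
      ← integral_add (int _ (by fun_prop)) (int _ (by fun_prop)),
      ← integral_add (int _ (by fun_prop)) (int _ (by fun_prop))]
    congr 1
    ext x
    ring
  have hexp : ∀ t : ℝ, HasDerivAt (fun t => Real.exp (k * t)) (Real.exp (k * t) * k) t := fun t => by
    simpa using ((hasDerivAt_id t).const_mul k).exp
  have e1 := sphere_ibp hp μ hμ (fun t => Real.exp (k * t)) (fun t => Real.exp (k * t) * k) hexp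
    (by fun_prop)
  have e2 := sphere_ibp hp μ hμ (fun t => t * Real.exp (k * t))
    (fun t => 1 * Real.exp (k * t) + t * (Real.exp (k * t) * k))
    (fun t => (hasDerivAt_id t).mul (hexp t)) (by fun_prop)
  have e1' := hsub (-k) ((p:ℝ) - 1) k 0
  have e2' := hsub (-1) (-k) (p:ℝ) k
  have f1 := e1'.symm.trans ((integral_congr_ae (Filter.Eventually.of_forall fun x => by
    ring)).trans e1)
  have f2 := e2'.symm.trans ((integral_congr_ae (Filter.Eventually.of_forall fun x => by
    ring)).trans e2)
  have hZ0 : 0 ≤ ∫ x : Metric.sphere (0 : EuclideanSpace ℝ (Fin p)) 1,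
            Real.exp (k * ⟪μ, (x : EuclideanSpace ℝ (Fin p))⟫)
            ∂((volume : Measure (EuclideanSpace ℝ (Fin p))).toSphere) :=
    integral_nonneg fun x => (Real.exp_pos _).le
  have hI2 : 0 ≤ ∫ x : Metric.sphere (0 : EuclideanSpace ℝ (Fin p)) 1,
            ⟪μ, (x : EuclideanSpace ℝ (Fin p))⟫ ^ 2 * Real.exp (k * ⟪μ, (x : EuclideanSpace ℝ (Fin p))⟫)
            ∂((volume : Measure (EuclideanSpace ℝ (Fin p))).toSphere) :=
    integral_nonneg fun x => mul_nonneg (sq_nonneg _) (Real.exp_pos _).le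
  have hm20 : 0 ≤ m2 := by rw [hm2]; exact div_nonneg hI2 hZ0
  obtain ⟨c, hc, hcm⟩ : ∃ c : ℝ, 0 ≤ c ∧ c ^ 2 = m2 := ⟨√m2, Real.sqrt_nonneg _, Real.sq_sqrt hm20⟩
  have hsym := sphere_symm μ (fun t => (c ^ 2 * (c * Real.sinh (k * c))
    + (-(c ^ 2 * Real.cosh (k * c))) * t ^ 1
    + (-(c * Real.sinh (k * c))) * t ^ 2 + Real.cosh (k * c) * t ^ 3) * Real.exp (k * t))
    (by fun_prop)
  have hpos : 0 ≤ ∫ x : Metric.sphere (0 : EuclideanSpace ℝ (Fin p)) 1,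
      (fun t => 2 * ((t ^ 2 - c ^ 2) * (t * Real.sinh (k * t) * Real.cosh (k * c)
      - c * Real.sinh (k * c) * Real.cosh (k * t)))) ⟪μ, (x : EuclideanSpace ℝ (Fin p))⟫
      ∂((volume : Measure (EuclideanSpace ℝ (Fin p))).toSphere) :=
    integral_nonneg fun x => mul_nonneg zero_le_two (cheb_nonneg' k hk _ c hc)
  have hcheb := hpos.trans_eq ((integral_congr_ae (Filter.Eventually.of_forall fun x => by
    dsimp only
    rw [Real.sinh_eq (k * ⟪μ, (x : EuclideanSpace ℝ (Fin p))⟫),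
      Real.cosh_eq (k * ⟪μ, (x : EuclideanSpace ℝ (Fin p))⟫), mul_neg]
    ring)).trans hsym)
  rw [hsub] at hcheb
  clear hsym hpos e1 e2 e1' e2' hsub int
  have hC := Real.cosh_pos (k * c)
  generalize Real.cosh (k * c) = C at *
  generalize c * Real.sinh (k * c) = S at *
  generalize (∫ x : Metric.sphere (0 : EuclideanSpace ℝ (Fin p)) 1,
            ⟪μ, (x : EuclideanSpace ℝ (Fin p))⟫ ^ 1 * Real.exp (k * ⟪μ, (x : EuclideanSpace ℝ (Fin p))⟫)
            ∂((volume : Measure (EuclideanSpace ℝ (Fin p))).toSphere)) = I1 at *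
  generalize (∫ x : Metric.sphere (0 : EuclideanSpace ℝ (Fin p)) 1,
            ⟪μ, (x : EuclideanSpace ℝ (Fin p))⟫ ^ 2 * Real.exp (k * ⟪μ, (x : EuclideanSpace ℝ (Fin p))⟫)
            ∂((volume : Measure (EuclideanSpace ℝ (Fin p))).toSphere)) = I2 at *
  generalize (∫ x : Metric.sphere (0 : EuclideanSpace ℝ (Fin p)) 1,
            ⟪μ, (x : EuclideanSpace ℝ (Fin p))⟫ ^ 3 * Real.exp (k * ⟪μ, (x : EuclideanSpace ℝ (Fin p))⟫)
            ∂((volume : Measure (EuclideanSpace ℝ (Fin p))).toSphere)) = I3 at *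
  generalize (∫ x : Metric.sphere (0 : EuclideanSpace ℝ (Fin p)) 1,
            Real.exp (k * ⟪μ, (x : EuclideanSpace ℝ (Fin p))⟫)
            ∂((volume : Measure (EuclideanSpace ℝ (Fin p))).toSphere)) = Z at *
  rcases hZ0.eq_or_lt with h0 | hZ
  · rw [← h0, div_zero] at hm1 hm2
    simp [hm1, hm2]
  have hp1 : (0:ℝ) < (p:ℝ) - 1 := by
    have : (2:ℝ) ≤ p := by exact_mod_cast hp
    linarith
  obtain rfl : I1 = m1 * Z := by rw [hm1]; field_simp
  obtain rfl : I2 = m2 * Z := by rw [hm2]; field_simp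
  obtain ⟨m3, rfl⟩ : ∃ m3, I3 = m3 * Z := ⟨I3 / Z, by field_simp⟩
  rw [hcm] at hcheb
  have g1 : -k + ((p:ℝ) - 1) * m1 + k * m2 = 0 := by
    apply mul_right_cancel₀ hZ.ne'; linarith
  have g2 : -1 - k * m1 + p * m2 + k * m3 = 0 := by
    apply mul_right_cancel₀ hZ.ne'; linarith
  have g3 : 0 ≤ m3 - m1 * m2 := by
    have : 0 ≤ (2 * C * Z) * (m3 - m1 * m2) := by linarith
    exact nonneg_of_mul_nonneg_right this (by positivity)
  have g4 : 0 ≤ ((p:ℝ) - 1) * k * (m1 ^ 2 - (m2 - m1 / k)) := by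
    have : ((p:ℝ) - 1) * k * (m1 ^ 2 - (m2 - m1 / k)) = k * (k * (m3 - m1 * m2)) := by
      field_simp
      linear_combination (k * m1 + 1) * g1 - k * g2
    rw [this]; positivity
  have := nonneg_of_mul_nonneg_right g4 (by positivity)
  linarith
end

section
/- (Bessel-moment identity.) Let σ be the surface measure on the unit sphere S^{p−1} ⊂ ℝ^p (p ≥ 2), μ ∈ S^{p−1}, k > 0, and define m_j = (∫ ⟨μ,x⟩^j e^{k⟨μ,x⟩} dσ)/(∫ e^{k⟨μ,x⟩} dσ) for j = 1, 2, 3. Set A = m_1, B = m_2 − m_1/k, and D = m_3 − 3m_2/k + 3m_1/k². Then k·D + 2B − k·A·B = p·(A² − B); equivalently, when A² > B, k(D + 2B/k − AB)/(A² − B) = p. -/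
open MeasureTheory RealInnerProductSpace

/-- The map induced on the unit sphere by a linear isometry equivalence. -/
noncomputable def sphMap {p : ℕ} (S : EuclideanSpace ℝ (Fin p) ≃ₗᵢ[ℝ] EuclideanSpace ℝ (Fin p))
    (x : Metric.sphere (0 : EuclideanSpace ℝ (Fin p)) 1) :
    Metric.sphere (0 : EuclideanSpace ℝ (Fin p)) 1 :=
  ⟨S x, by simp⟩

open scoped Pointwise in
lemma sphMap_mp {p : ℕ} (S : EuclideanSpace ℝ (Fin p) ≃ₗᵢ[ℝ] EuclideanSpace ℝ (Fin p)) :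
    MeasurePreserving (sphMap S) (volume : Measure (EuclideanSpace ℝ (Fin p))).toSphere
      (volume : Measure (EuclideanSpace ℝ (Fin p))).toSphere := by
  have hm : Measurable (sphMap S) := by
    apply Measurable.subtype_mk
    exact S.continuous.measurable.comp measurable_subtype_coe
  refine ⟨hm, ?_⟩
  ext s hs
  rw [Measure.map_apply hm hs, Measure.toSphere_apply' _ (hm hs), Measure.toSphere_apply' _ hs]
  congr 1
  have : Set.Ioo (0:ℝ) 1 • ((↑) '' (sphMap S ⁻¹' s) : Set (EuclideanSpace ℝ (Fin p)))
      = S ⁻¹' (Set.Ioo (0:ℝ) 1 • ((↑) '' s : Set (EuclideanSpace ℝ (Fin p)))) := by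
    ext y
    simp only [Set.mem_smul, Set.mem_image, Set.mem_preimage]
    constructor
    · rintro ⟨r, hr, _, ⟨x, hx, rfl⟩, rfl⟩
      exact ⟨r, hr, _, ⟨_, hx, rfl⟩, by simp [sphMap]⟩
    · rintro ⟨r, hr, _, ⟨x, hx, rfl⟩, h⟩
      have hx' : sphMap S (sphMap S.symm x) = x := by ext1; simp [sphMap]
      refine ⟨r, hr, _, ⟨sphMap S.symm x, by rwa [hx'], rfl⟩, ?_⟩
      apply S.injective
      rw [← h]; simp [sphMap]
  rw [this]
  exact (S.measurePreserving).measure_preimage_equiv (f := S.toMeasurableEquiv) _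

lemma sph_integrable {p : ℕ} (g : Metric.sphere (0 : EuclideanSpace ℝ (Fin p)) 1 → ℝ)
    (hg : Continuous g) :
    Integrable g (volume : Measure (EuclideanSpace ℝ (Fin p))).toSphere := by
  exact hg.integrable_of_hasCompactSupport (HasCompactSupport.of_compactSpace g)

/-- Invariance under a reflection in the plane of `μ, v`. -/
lemma refl_inv {p : ℕ} (μ v : EuclideanSpace ℝ (Fin p)) (hμ : ‖μ‖ = 1) (hv : ‖v‖ = 1)
    (hμv : ⟪μ, v⟫ = 0) (f : ℝ → ℝ) (hf : Continuous f) (a : ℝ) :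
    ∫ x : Metric.sphere (0 : EuclideanSpace ℝ (Fin p)) 1,
      (Real.sin (2 * a) * ⟪μ, x.1⟫ - Real.cos (2 * a) * ⟪v, x.1⟫) *
        f (Real.cos (2 * a) * ⟪μ, x.1⟫ + Real.sin (2 * a) * ⟪v, x.1⟫)
      ∂(volume : Measure (EuclideanSpace ℝ (Fin p))).toSphere
    = ∫ x : Metric.sphere (0 : EuclideanSpace ℝ (Fin p)) 1, ⟪v, x.1⟫ * f ⟪μ, x.1⟫
      ∂(volume : Measure (EuclideanSpace ℝ (Fin p))).toSphere := by
  set u : EuclideanSpace ℝ (Fin p) := Real.sin a • μ - Real.cos a • v with hu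
  have hvμ : ⟪v, μ⟫ = 0 := by rw [real_inner_comm]; exact hμv
  have hun : ‖u‖ = 1 := by
    have : ‖u‖ ^ 2 = 1 := by
      rw [← real_inner_self_eq_norm_sq, hu]
      simp only [inner_sub_left, inner_sub_right, real_inner_smul_left, real_inner_smul_right,
        hμv, hvμ, real_inner_self_eq_norm_sq, norm_smul, hμ, hv, mul_pow, Real.norm_eq_abs, sq_abs]
      have := Real.sin_sq_add_cos_sq a
      linarith
    nlinarith [norm_nonneg u]
  set S := (Submodule.span ℝ {u})ᗮ.reflection with hS
  have hSx : ∀ x, S x = x - (2 * ⟪u, x⟫) • u := by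
    intro x
    rw [hS, Submodule.reflection_orthogonal_apply, Submodule.reflection_singleton_apply, hun]
    simp [two_smul, mul_smul]
  have h1 : ∀ x, ⟪μ, S x⟫ = Real.cos (2 * a) * ⟪μ, x⟫ + Real.sin (2 * a) * ⟪v, x⟫ := by
    intro x
    rw [hSx, hu]
    simp only [inner_sub_left, inner_sub_right, real_inner_smul_left, real_inner_smul_right,
        hμv, hvμ, real_inner_self_eq_norm_sq, hμ, hv]
    rw [Real.cos_two_mul, Real.sin_two_mul]
    linear_combination (-2 * ⟪μ, x⟫) * Real.sin_sq_add_cos_sq a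
  have h2 : ∀ x, ⟪v, S x⟫ = Real.sin (2 * a) * ⟪μ, x⟫ - Real.cos (2 * a) * ⟪v, x⟫ := by
    intro x
    rw [hSx, hu]
    simp only [inner_sub_left, inner_sub_right, real_inner_smul_left, real_inner_smul_right,
        hμv, hvμ, real_inner_self_eq_norm_sq, hμ, hv]
    rw [Real.cos_two_mul, Real.sin_two_mul]
    ring
  have hmp := sphMap_mp S
  have hc : Continuous (fun x : Metric.sphere (0 : EuclideanSpace ℝ (Fin p)) 1 =>
      ⟪v, x.1⟫ * f ⟪μ, x.1⟫) := by fun_prop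
  have := integral_map (μ := (volume : Measure (EuclideanSpace ℝ (Fin p))).toSphere)
    hmp.measurable.aemeasurable (f := fun x => ⟪v, x.1⟫ * f ⟪μ, x.1⟫)
    hc.aestronglyMeasurable
  rw [hmp.map_eq] at this
  rw [this]
  congr 1
  ext x
  simp only [sphMap, h1, h2]

lemma sph_ibp {p : ℕ} (μ v : EuclideanSpace ℝ (Fin p)) (hμ : ‖μ‖ = 1) (hv : ‖v‖ = 1)
    (hμv : ⟪μ, v⟫ = 0) (f f' : ℝ → ℝ) (hf : ∀ t, HasDerivAt f (f' t) t) (hf' : Continuous f') :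
    ∫ x : Metric.sphere (0 : EuclideanSpace ℝ (Fin p)) 1,
      (⟪μ, x.1⟫ * f ⟪μ, x.1⟫ - ⟪v, x.1⟫ ^ 2 * f' ⟪μ, x.1⟫)
      ∂(volume : Measure (EuclideanSpace ℝ (Fin p))).toSphere = 0 := by
  have hfc : Continuous f := continuous_iff_continuousAt.2 fun t => (hf t).continuousAt
  set σ := (volume : Measure (EuclideanSpace ℝ (Fin p))).toSphere
  let F : ℝ → Metric.sphere (0 : EuclideanSpace ℝ (Fin p)) 1 → ℝ := fun a x =>
      (Real.sin (2 * a) * ⟪μ, x.1⟫ - Real.cos (2 * a) * ⟪v, x.1⟫) *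
        f (Real.cos (2 * a) * ⟪μ, x.1⟫ + Real.sin (2 * a) * ⟪v, x.1⟫)
  let F' : ℝ → Metric.sphere (0 : EuclideanSpace ℝ (Fin p)) 1 → ℝ := fun a x =>
      (Real.cos (2 * a) * 2 * ⟪μ, x.1⟫ - -Real.sin (2 * a) * 2 * ⟪v, x.1⟫) *
        f (Real.cos (2 * a) * ⟪μ, x.1⟫ + Real.sin (2 * a) * ⟪v, x.1⟫) +
      (Real.sin (2 * a) * ⟪μ, x.1⟫ - Real.cos (2 * a) * ⟪v, x.1⟫) *
        (f' (Real.cos (2 * a) * ⟪μ, x.1⟫ + Real.sin (2 * a) * ⟪v, x.1⟫) *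
          (-Real.sin (2 * a) * 2 * ⟪μ, x.1⟫ + Real.cos (2 * a) * 2 * ⟪v, x.1⟫))
  have hd : ∀ a x, HasDerivAt (fun a => F a x) (F' a x) a := by
    intro a x
    have h2 : HasDerivAt (fun a : ℝ => 2 * a) 2 a := by
      simpa using (hasDerivAt_id a).const_mul (2 : ℝ)
    have hs := (Real.hasDerivAt_sin (2 * a)).comp a h2
    have hc := (Real.hasDerivAt_cos (2 * a)).comp a h2
    exact ((hs.mul_const _).sub (hc.mul_const _)).mul
      ((hf _).comp a ((hc.mul_const _).add (hs.mul_const _)))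
  have hF'c : Continuous (Function.uncurry F') := by
    simp only [F', Function.uncurry_def]
    fun_prop
  obtain ⟨C, hC⟩ := ((isCompact_Icc (a := (-1:ℝ)) (b := 1)).prod
    (isCompact_univ (X := Metric.sphere (0 : EuclideanSpace ℝ (Fin p)) 1))).exists_bound_of_continuousOn
    hF'c.continuousOn
  have key := hasDerivAt_integral_of_dominated_loc_of_deriv_le (μ := σ) (F := F) (F' := F')
    (x₀ := 0) (s := Set.Icc (-1) 1) (bound := fun _ => C)
    (Icc_mem_nhds (by norm_num) (by norm_num))
    (Filter.Eventually.of_forall fun a => by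
      apply Continuous.aestronglyMeasurable
      simp only [F]; fun_prop)
    (by apply sph_integrable; simp only [F]; fun_prop)
    (by apply Continuous.aestronglyMeasurable
        simp only [F']; fun_prop)
    (Filter.Eventually.of_forall fun x a ha => hC (a, x) ⟨ha, trivial⟩)
    (integrable_const _)
    (Filter.Eventually.of_forall fun x a _ => hd a x)
  have hconst : (fun a => ∫ x, F a x ∂σ) = fun _ => ∫ x, ⟪v, x.1⟫ * f ⟪μ, x.1⟫ ∂σ := by
    ext a
    exact refl_inv μ v hμ hv hμv f hfc a
  have h0 := key.2
  rw [hconst] at h0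
  have h1 := h0.unique (hasDerivAt_const _ _)
  have h2 : (∫ x, F' 0 x ∂σ) = 2 * ∫ x : Metric.sphere (0 : EuclideanSpace ℝ (Fin p)) 1,
      (⟪μ, x.1⟫ * f ⟪μ, x.1⟫ - ⟪v, x.1⟫ ^ 2 * f' ⟪μ, x.1⟫) ∂σ := by
    rw [← integral_const_mul]
    congr 1
    ext x
    simp [F']
    ring
  linarith

lemma sph_main {p : ℕ} (hp : 2 ≤ p) (μ : EuclideanSpace ℝ (Fin p)) (hμ : ‖μ‖ = 1)
    (f f' : ℝ → ℝ) (hf : ∀ t, HasDerivAt f (f' t) t) (hf' : Continuous f') :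
    ∫ x : Metric.sphere (0 : EuclideanSpace ℝ (Fin p)) 1,
      (((p : ℝ) - 1) * (⟪μ, x.1⟫ * f ⟪μ, x.1⟫) - (1 - ⟪μ, x.1⟫ ^ 2) * f' ⟪μ, x.1⟫)
      ∂(volume : Measure (EuclideanSpace ℝ (Fin p))).toSphere = 0 := by
  have hfc : Continuous f := continuous_iff_continuousAt.2 fun t => (hf t).continuousAt
  let i0 : Fin p := ⟨0, by omega⟩
  obtain ⟨b, hb⟩ := Orthonormal.exists_orthonormalBasis_extension_of_card_eq (𝕜 := ℝ)
    (E := EuclideanSpace ℝ (Fin p)) (ι := Fin p) (by simp) (v := fun _ => μ) (s := {i0})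
    (by
      constructor
      · intro i; simpa using hμ
      · intro i j hij; exact absurd (Subsingleton.elim i j) hij)
  have hb0 : b i0 = μ := hb i0 rfl
  have hsum : ∑ i ∈ Finset.univ.erase i0,
      ∫ x : Metric.sphere (0 : EuclideanSpace ℝ (Fin p)) 1,
      (⟪μ, x.1⟫ * f ⟪μ, x.1⟫ - ⟪b i, x.1⟫ ^ 2 * f' ⟪μ, x.1⟫)
      ∂(volume : Measure (EuclideanSpace ℝ (Fin p))).toSphere = 0 := by
    apply Finset.sum_eq_zero
    intro i hi
    apply sph_ibp μ (b i) hμ (b.norm_eq_one i) _ f f' hf hf'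
    rw [← hb0]
    exact b.inner_eq_zero (Finset.ne_of_mem_erase hi).symm
  rw [← integral_finsetSum _ (fun i _ => sph_integrable _ (by fun_prop))] at hsum
  rw [← hsum]
  congr 1
  ext x
  have hx : ‖x.1‖ = 1 := by simp
  have h := b.sum_sq_norm_inner_right x.1
  rw [hx, ← Finset.add_sum_erase _ _ (Finset.mem_univ i0), hb0] at h
  simp only [Real.norm_eq_abs, sq_abs] at h
  have h' : ∑ i ∈ Finset.univ.erase i0, ⟪b i, x.1⟫ ^ 2 = 1 - ⟪μ, x.1⟫ ^ 2 := by linarith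
  rw [Finset.sum_sub_distrib, Finset.sum_const, ← Finset.sum_mul, h',
    Finset.card_erase_of_mem (Finset.mem_univ _), Finset.card_univ, Fintype.card_fin,
    nsmul_eq_mul, Nat.cast_sub (by omega)]
  simp

/-- Bessel-moment identity: For the surface measure σ on S^{p−1} ⊂ ℝ^p
(p ≥ 2), μ ∈ S^{p−1}, k > 0, and moments m_j of ⟨μ,x⟩ under the vMF distribution, with
A = m_1, B = m_2 − m_1/k, D = m_3 − 3m_2/k + 3m_1/k², one has
k·D + 2B − k·A·B = p·(A² − B); equivalently, when A² > B,
k(D + 2B/k − AB)/(A² − B) = p. -/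
theorem stmt17 (p : ℕ) (hp : 2 ≤ p) (k : ℝ) (hk : 0 < k)
    (μ : EuclideanSpace ℝ (Fin p)) (hμ : ‖μ‖ = 1)
    (m1 m2 m3 : ℝ)
    (hm1 : m1 = (∫ x : Metric.sphere (0 : EuclideanSpace ℝ (Fin p)) 1,
          ⟪μ, (x : EuclideanSpace ℝ (Fin p))⟫ ^ 1 *
            Real.exp (k * ⟪μ, (x : EuclideanSpace ℝ (Fin p))⟫)
          ∂((volume : Measure (EuclideanSpace ℝ (Fin p))).toSphere))
        / (∫ x : Metric.sphere (0 : EuclideanSpace ℝ (Fin p)) 1,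
            Real.exp (k * ⟪μ, (x : EuclideanSpace ℝ (Fin p))⟫)
            ∂((volume : Measure (EuclideanSpace ℝ (Fin p))).toSphere)))
    (hm2 : m2 = (∫ x : Metric.sphere (0 : EuclideanSpace ℝ (Fin p)) 1,
          ⟪μ, (x : EuclideanSpace ℝ (Fin p))⟫ ^ 2 *
            Real.exp (k * ⟪μ, (x : EuclideanSpace ℝ (Fin p))⟫)
          ∂((volume : Measure (EuclideanSpace ℝ (Fin p))).toSphere))
        / (∫ x : Metric.sphere (0 : EuclideanSpace ℝ (Fin p)) 1,
            Real.exp (k * ⟪μ, (x : EuclideanSpace ℝ (Fin p))⟫)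
            ∂((volume : Measure (EuclideanSpace ℝ (Fin p))).toSphere)))
    (hm3 : m3 = (∫ x : Metric.sphere (0 : EuclideanSpace ℝ (Fin p)) 1,
          ⟪μ, (x : EuclideanSpace ℝ (Fin p))⟫ ^ 3 *
            Real.exp (k * ⟪μ, (x : EuclideanSpace ℝ (Fin p))⟫)
          ∂((volume : Measure (EuclideanSpace ℝ (Fin p))).toSphere))
        / (∫ x : Metric.sphere (0 : EuclideanSpace ℝ (Fin p)) 1,
            Real.exp (k * ⟪μ, (x : EuclideanSpace ℝ (Fin p))⟫)
            ∂((volume : Measure (EuclideanSpace ℝ (Fin p))).toSphere)))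
    (A B D : ℝ) (hA : A = m1) (hB : B = m2 - m1 / k)
    (hD : D = m3 - 3 * m2 / k + 3 * m1 / k ^ 2) :
    k * D + 2 * B - k * A * B = p * (A ^ 2 - B)
    ∧ (A ^ 2 > B → k * (D + 2 * B / k - A * B) / (A ^ 2 - B) = p) := by
  set σ := (volume : Measure (EuclideanSpace ℝ (Fin p))).toSphere with hσ
  set Z := ∫ x : Metric.sphere (0 : EuclideanSpace ℝ (Fin p)) 1, Real.exp (k * ⟪μ, x.1⟫) ∂σ with hZ
  have i0 : Integrable (fun x : Metric.sphere (0 : EuclideanSpace ℝ (Fin p)) 1 =>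
    Real.exp (k * ⟪μ, x.1⟫)) σ := sph_integrable _ (by fun_prop)
  have ij : ∀ j : ℕ, Integrable (fun x : Metric.sphere (0 : EuclideanSpace ℝ (Fin p)) 1 =>
    ⟪μ, x.1⟫ ^ j * Real.exp (k * ⟪μ, x.1⟫)) σ := fun j => sph_integrable _ (by fun_prop)
  have hZpos : 0 < Z := by
    have : Nonempty (Fin p) := ⟨⟨0, by omega⟩⟩
    have : NeZero σ := ⟨Measure.toSphere_ne_zero _⟩
    exact integral_exp_pos i0
  set M1 := ∫ x : Metric.sphere (0 : EuclideanSpace ℝ (Fin p)) 1,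
    ⟪μ, x.1⟫ ^ 1 * Real.exp (k * ⟪μ, x.1⟫) ∂σ with hM1
  set M2 := ∫ x : Metric.sphere (0 : EuclideanSpace ℝ (Fin p)) 1,
    ⟪μ, x.1⟫ ^ 2 * Real.exp (k * ⟪μ, x.1⟫) ∂σ with hM2
  set M3 := ∫ x : Metric.sphere (0 : EuclideanSpace ℝ (Fin p)) 1,
    ⟪μ, x.1⟫ ^ 3 * Real.exp (k * ⟪μ, x.1⟫) ∂σ with hM3
  have hexp : ∀ t : ℝ, HasDerivAt (fun t => Real.exp (k * t)) (Real.exp (k * t) * k) t := by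
    intro t
    have h2 : HasDerivAt (fun a : ℝ => k * a) k t := by
      simpa using (hasDerivAt_id t).const_mul k
    exact h2.exp
  have e1 := sph_main hp μ hμ _ _ hexp (by fun_prop)
  have e2 := sph_main hp μ hμ (fun t => t * Real.exp (k * t))
    (fun t => 1 * Real.exp (k * t) + t * (Real.exp (k * t) * k))
    (fun t => (hasDerivAt_id t).mul (hexp t)) (by fun_prop)
  have E1 : ((p : ℝ) - 1) * M1 + (-k) * Z + k * M2 = 0 := by
    rw [← e1, hM1, hM2, hZ, ← integral_const_mul, ← integral_const_mul, ← integral_const_mul,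
      ← integral_add ((ij 1).const_mul _) (i0.const_mul _),
      ← integral_add (sph_integrable _ (by fun_prop)) ((ij 2).const_mul _)]
    congr 1
    ext x
    ring
  have E2 : ((p : ℝ) * M2 + (-1) * Z) + ((-k) * M1 + k * M3) = 0 := by
    rw [← e2, hM1, hM2, hM3, hZ, ← integral_const_mul, ← integral_const_mul,
      ← integral_const_mul, ← integral_const_mul,
      ← integral_add ((ij 2).const_mul _) (i0.const_mul _),
      ← integral_add ((ij 1).const_mul _) ((ij 3).const_mul _),
      ← integral_add (sph_integrable _ (by fun_prop)) (sph_integrable _ (by fun_prop))]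
    congr 1
    ext x
    ring
  have r1 : M1 = m1 * Z := by rw [hm1]; field_simp
  have r2 : M2 = m2 * Z := by rw [hm2]; field_simp
  have r3 : M3 = m3 * Z := by rw [hm3]; field_simp
  rw [r1, r2] at E1
  rw [r1, r2, r3] at E2
  have G1 : ((p : ℝ) - 1) * m1 - k + k * m2 = 0 := by
    apply mul_right_cancel₀ hZpos.ne'
    linear_combination E1
  have G2 : (p : ℝ) * m2 - 1 - k * m1 + k * m3 = 0 := by
    apply mul_right_cancel₀ hZpos.ne'
    linear_combination E2
  have main : k * D + 2 * B - k * A * B = p * (A ^ 2 - B) := by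
    rw [hD, hB, hA]
    field_simp
    linear_combination k * G2 - (1 + k * m1) * G1
  refine ⟨main, fun h => ?_⟩
  have hne : A ^ 2 - B ≠ 0 := by linarith [h] |> fun (h : A ^ 2 - B > 0) => h.ne'
  rw [div_eq_iff hne, ← main]
  field_simp
end

section
/- (Theorem 2, integral form.) Let σ be the surface measure on the unit sphere S^{p−1} ⊂ ℝ^p (p ≥ 2), k > 0, μ ∈ S^{p−1}, and W a symmetric p × p real matrix with ‖Wv‖ ≤ ‖v‖ for all v ∈ ℝ^p. If μᵀWμ ≥ (1/p) Tr W, then ‖∫_{S^{p−1}} (1 + xᵀWx) x e^{k⟨μ,x⟩} dσ(x)‖ · ∫_{S^{p−1}} e^{k⟨μ,x⟩} dσ(x) ≥ ‖∫_{S^{p−1}} x e^{k⟨μ,x⟩} dσ(x)‖ · ∫_{S^{p−1}} (1 + xᵀWx) e^{k⟨μ,x⟩} dσ(x); i.e. the resultant length ‖𝔼[x]‖ of the Bayesian posterior is at least that of the von Mises–Fisher prior. -/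
open MeasureTheory RealInnerProductSpace Matrix

/-- Surface integral on the unit sphere. -/
noncomputable def sphInt (p : ℕ) (F : EuclideanSpace ℝ (Fin p) → ℝ) : ℝ :=
  ∫ x : Metric.sphere (0 : EuclideanSpace ℝ (Fin p)) 1, F x
    ∂((volume : Measure (EuclideanSpace ℝ (Fin p))).toSphere)

theorem sph_integrable_s18 {p : ℕ} {G : Type*} [NormedAddCommGroup G]
    {F : EuclideanSpace ℝ (Fin p) → G}
    (hF : Continuous F) : Integrable (fun x : Metric.sphere (0 : EuclideanSpace ℝ (Fin p)) 1 => F x)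
      ((volume : Measure (EuclideanSpace ℝ (Fin p))).toSphere) := by
  have h : Continuous (fun x : Metric.sphere (0 : EuclideanSpace ℝ (Fin p)) 1 => F x) :=
    hF.comp continuous_subtype_val
  exact h.integrable_of_hasCompactSupport (HasCompactSupport.of_compactSpace _)

theorem sphInt_add {p : ℕ} {F G : EuclideanSpace ℝ (Fin p) → ℝ} (hF : Continuous F)
    (hG : Continuous G) : sphInt p (fun x => F x + G x) = sphInt p F + sphInt p G :=
  integral_add (sph_integrable_s18 hF) (sph_integrable_s18 hG)

theorem sphInt_sub {p : ℕ} {F G : EuclideanSpace ℝ (Fin p) → ℝ} (hF : Continuous F)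
    (hG : Continuous G) : sphInt p (fun x => F x - G x) = sphInt p F - sphInt p G :=
  integral_sub (sph_integrable_s18 hF) (sph_integrable_s18 hG)

theorem sphInt_smul {p : ℕ} (c : ℝ) (F : EuclideanSpace ℝ (Fin p) → ℝ) :
    sphInt p (fun x => c * F x) = c * sphInt p F :=
  integral_const_mul c _

theorem sphInt_sum {p : ℕ} {ι : Type*} (s : Finset ι) {F : ι → EuclideanSpace ℝ (Fin p) → ℝ}
    (hF : ∀ i, Continuous (F i)) :
    sphInt p (fun x => ∑ i ∈ s, F i x) = ∑ i ∈ s, sphInt p (F i) :=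
  integral_finsetSum s (fun i _ => sph_integrable_s18 (hF i))

theorem sphInt_nonneg {p : ℕ} {F : EuclideanSpace ℝ (Fin p) → ℝ} (hF : ∀ x, 0 ≤ F x) :
    0 ≤ sphInt p F := integral_nonneg (fun x => hF x)

open scoped Pointwise in
theorem sphInt_isom {p : ℕ} (L : EuclideanSpace ℝ (Fin p) ≃ₗᵢ[ℝ] EuclideanSpace ℝ (Fin p))
    (F : EuclideanSpace ℝ (Fin p) → ℝ) :
    sphInt p (fun x => F (L x)) = sphInt p F := by
  let e : Metric.sphere (0 : EuclideanSpace ℝ (Fin p)) 1 ≃ₜ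
      Metric.sphere (0 : EuclideanSpace ℝ (Fin p)) 1 :=
    { toFun := fun x => ⟨L x, by simp⟩
      invFun := fun x => ⟨L.symm x, by simp⟩
      left_inv := fun x => by simp
      right_inv := fun x => by simp
      continuous_toFun := by fun_prop
      continuous_invFun := by fun_prop }
  have hmp : MeasurePreserving e ((volume : Measure (EuclideanSpace ℝ (Fin p))).toSphere)
      ((volume : Measure (EuclideanSpace ℝ (Fin p))).toSphere) := by
    refine ⟨e.continuous.measurable, ?_⟩
    ext s hs
    rw [Measure.map_apply e.continuous.measurable hs, Measure.toSphere_apply' _ hs,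
      Measure.toSphere_apply' _ (e.continuous.measurable hs)]
    congr 1
    rw [← MeasurePreserving.measure_preimage_equiv (f := L.toMeasurableEquiv) L.measurePreserving
      (Set.Ioo (0 : ℝ) 1 • (Subtype.val '' s))]
    congr 1
    ext y
    simp only [Set.mem_smul, Set.mem_preimage, Set.mem_image]
    constructor
    · rintro ⟨r, hr, _, ⟨x, hx, rfl⟩, rfl⟩
      exact ⟨r, hr, _, ⟨e x, hx, rfl⟩, (map_smul L r (x : EuclideanSpace ℝ (Fin p))).symm⟩
    · rintro ⟨r, hr, _, ⟨x, hx, rfl⟩, h⟩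
      refine ⟨r, hr, _, ⟨e.symm x, by simpa using hx, rfl⟩, ?_⟩
      apply L.injective
      have : L (e.symm x : EuclideanSpace ℝ (Fin p)) = x := by simp [e]
      rw [map_smul, this]
      exact h
  exact hmp.integral_comp e.measurableEmbedding (fun x => F x)

theorem sphInt_neg {p : ℕ} (F : EuclideanSpace ℝ (Fin p) → ℝ) :
    sphInt p (fun x => F (-x)) = sphInt p F :=
  sphInt_isom (LinearIsometryEquiv.neg ℝ) F

/-- Invariance of the weighted form under changes of vector keeping norm and the product with μ. -/
theorem sphInt_rot {p : ℕ} (μ u v : EuclideanSpace ℝ (Fin p)) (huv : ‖u‖ = ‖v‖)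
    (hm : ⟪u, μ⟫ = ⟪v, μ⟫) (H : ℝ → ℝ → ℝ) :
    sphInt p (fun x => H ⟪μ, x⟫ ⟪u, x⟫) = sphInt p (fun x => H ⟪μ, x⟫ ⟪v, x⟫) := by
  set L := (ℝ ∙ (u - v))ᗮ.reflection with hL
  have h1 : L u = v := Submodule.reflection_sub huv
  have h2 : L μ = μ := by
    apply Submodule.reflection_mem_subspace_eq_self
    rw [Submodule.mem_orthogonal_singleton_iff_inner_right, inner_sub_left, hm, sub_self]
  rw [← sphInt_isom L]
  congr 1
  ext x
  have e1 : ⟪μ, L x⟫ = ⟪μ, x⟫ := by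
    conv_lhs => rw [← h2]
    exact L.inner_map_map _ _
  have e2 : ⟪u, L x⟫ = ⟪v, x⟫ := by
    rw [← h1, ← L.inner_map_map u (L x), hL, Submodule.reflection_reflection]
  rw [e1, e2]

theorem quad_form {p : ℕ} (hp : 2 ≤ p) (μ : EuclideanSpace ℝ (Fin p)) (hμ : ‖μ‖ = 1)
    (f : ℝ → ℝ) (hf : Continuous f) : ∃ c d : ℝ, ∀ u : EuclideanSpace ℝ (Fin p),
      sphInt p (fun x => f ⟪μ, x⟫ * ⟪u, x⟫ ^ 2) = c * ‖u‖ ^ 2 + d * ⟪u, μ⟫ ^ 2 := by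
  obtain ⟨v, hv1, hv2⟩ : ∃ v : EuclideanSpace ℝ (Fin p), ‖v‖ = 1 ∧ ⟪v, μ⟫ = 0 := by
    have h : ∃ v ∈ (ℝ ∙ μ)ᗮ, v ≠ 0 := by
      apply Submodule.exists_mem_ne_zero_of_ne_bot
      intro h
      rw [Submodule.orthogonal_eq_bot_iff] at h
      have h1 := finrank_span_le_card (R := ℝ) ({μ} : Set (EuclideanSpace ℝ (Fin p)))
      rw [h, finrank_top] at h1
      simp at h1
      omega
    obtain ⟨v, hv, hv0⟩ := h
    rw [Submodule.mem_orthogonal_singleton_iff_inner_left] at hv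
    refine ⟨(‖v‖⁻¹ : ℝ) • v, ?_, ?_⟩
    · rw [norm_smul, norm_inv, norm_norm, inv_mul_cancel₀ (norm_ne_zero_iff.2 hv0)]
    · rw [inner_smul_left, hv, mul_zero]
  have hμμ : ⟪μ, μ⟫ = 1 := by rw [real_inner_self_eq_norm_sq, hμ, one_pow]
  set c := sphInt p (fun x => f ⟪μ, x⟫ * ⟪v, x⟫ ^ 2) with hc
  set m := sphInt p (fun x => f ⟪μ, x⟫ * ⟪μ, x⟫ ^ 2) with hm
  refine ⟨c, m - c, fun u => ?_⟩
  set a := ⟪u, μ⟫ with ha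
  set w := u - a • μ with hw
  have hwμ : ⟪w, μ⟫ = 0 := by
    rw [hw, inner_sub_left, real_inner_smul_left, hμμ, ← ha]; ring
  have hnw : ‖w‖ ^ 2 = ‖u‖ ^ 2 - a ^ 2 := by
    rw [← real_inner_self_eq_norm_sq, ← real_inner_self_eq_norm_sq]
    conv_lhs => rw [hw]
    simp only [inner_sub_left, inner_sub_right, real_inner_smul_left, real_inner_smul_right, hμμ,
      real_inner_comm u μ, ← ha]
    ring
  -- the orthogonal part
  have k1 : sphInt p (fun x => f ⟪μ, x⟫ * ⟪w, x⟫ ^ 2) = ‖w‖ ^ 2 * c := by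
    rw [sphInt_rot μ w (‖w‖ • v) (by rw [norm_smul, hv1]; simp)
      (by rw [hwμ, real_inner_smul_left, hv2, mul_zero]) (fun s t => f s * t ^ 2),
      hc, ← sphInt_smul]
    congr 1; ext x; rw [real_inner_smul_left]; ring
  have k2 : sphInt p (fun x => f ⟪μ, x⟫ * (⟪μ, x⟫ * ⟪w, x⟫)) = 0 := by
    have h := sphInt_rot μ w (-w) (by simp) (by rw [inner_neg_left, hwμ, neg_zero])
      (fun s t => f s * (s * t))
    have h' : sphInt p (fun x => f ⟪μ, x⟫ * (⟪μ, x⟫ * ⟪-w, x⟫)) =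
        (-1) * sphInt p (fun x => f ⟪μ, x⟫ * (⟪μ, x⟫ * ⟪w, x⟫)) := by
      rw [← sphInt_smul]; congr 1; ext x; rw [inner_neg_left]; ring
    linarith
  have k3 : (fun x => f ⟪μ, x⟫ * ⟪u, x⟫ ^ 2) = fun x =>
      (a ^ 2 * (f ⟪μ, x⟫ * ⟪μ, x⟫ ^ 2) + (2 * a) * (f ⟪μ, x⟫ * (⟪μ, x⟫ * ⟪w, x⟫)))
       + f ⟪μ, x⟫ * ⟪w, x⟫ ^ 2 := by
    ext x
    have : u = a • μ + w := by rw [hw]; abel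
    conv_lhs => rw [this]
    rw [inner_add_left, real_inner_smul_left]; ring
  rw [k3, sphInt_add (by fun_prop) (by fun_prop), sphInt_add (by fun_prop) (by fun_prop),
    sphInt_smul, sphInt_smul, k1, k2, ← hm, hnw]
  ring

theorem inner_toEuc {p : ℕ} (W : Matrix (Fin p) (Fin p) ℝ) (x : EuclideanSpace ℝ (Fin p)) :
    ⟪x, Matrix.toEuclideanLin W x⟫ = ∑ i, ∑ j, W i j * (x i * x j) := by
  simp only [PiLp.inner_apply, Matrix.toEuclideanLin_apply, Matrix.mulVec, dotProduct,
    RCLike.inner_apply, conj_trivial, Finset.sum_mul]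
  refine Finset.sum_congr rfl fun i _ => Finset.sum_congr rfl fun j _ => ?_
  ring

theorem bil_form {p : ℕ} (hp : 2 ≤ p) (μ : EuclideanSpace ℝ (Fin p)) (hμ : ‖μ‖ = 1)
    (f : ℝ → ℝ) (hf : Continuous f) : ∃ c d : ℝ, ∀ W : Matrix (Fin p) (Fin p) ℝ,
      sphInt p (fun x => f ⟪μ, x⟫ * ⟪x, Matrix.toEuclideanLin W x⟫) =
        c * W.trace + d * ⟪μ, Matrix.toEuclideanLin W μ⟫ := by
  obtain ⟨c, d, h⟩ := quad_form hp μ hμ f hf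
  refine ⟨c, d, fun W => ?_⟩
  have hB : ∀ i j : Fin p, sphInt p (fun x => f ⟪μ, x⟫ * (x i * x j)) =
      c * (if i = j then 1 else 0) + d * (μ i * μ j) := by
    intro i j
    set u : EuclideanSpace ℝ (Fin p) := EuclideanSpace.single i 1
    set v : EuclideanSpace ℝ (Fin p) := EuclideanSpace.single j 1
    have hu : ∀ x, ⟪u, x⟫ = x i := fun x => by simp [u, EuclideanSpace.inner_single_left]
    have hv : ∀ x, ⟪v, x⟫ = x j := fun x => by simp [v, EuclideanSpace.inner_single_left]
    have huv : ⟪u, v⟫ = if i = j then 1 else 0 := by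
      rw [hu]; simp [v, Pi.single_apply]
    have e : (fun x : EuclideanSpace ℝ (Fin p) => f ⟪μ, x⟫ * (x i * x j)) = fun x =>
        (1/4) * (f ⟪μ, x⟫ * ⟪u + v, x⟫ ^ 2 - f ⟪μ, x⟫ * ⟪u - v, x⟫ ^ 2) := by
      ext x
      rw [inner_add_left, inner_sub_left, hu, hv]; ring
    rw [e, sphInt_smul, sphInt_sub (by fun_prop) (by fun_prop), h, h, inner_add_left,
      inner_sub_left, hu, hv, norm_add_sq_real, norm_sub_sq_real, huv]
    ring
  have e : (fun x : EuclideanSpace ℝ (Fin p) => f ⟪μ, x⟫ * ⟪x, Matrix.toEuclideanLin W x⟫) =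
      fun x => ∑ i, ∑ j, W i j * (f ⟪μ, x⟫ * (x i * x j)) := by
    ext x
    rw [inner_toEuc, Finset.mul_sum]
    refine Finset.sum_congr rfl fun i _ => ?_
    rw [Finset.mul_sum]
    refine Finset.sum_congr rfl fun j _ => ?_
    ring
  rw [e, sphInt_sum _ (fun i => by fun_prop), inner_toEuc, Matrix.trace, Finset.mul_sum,
    Finset.mul_sum, ← Finset.sum_add_distrib]
  refine Finset.sum_congr rfl fun i _ => ?_
  rw [sphInt_sum _ (fun j => by fun_prop)]
  simp only [sphInt_smul, hB, mul_add, Finset.sum_add_distrib, Finset.mul_sum]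
  congr 1
  · simp [Matrix.diag, mul_comm]
  · refine Finset.sum_congr rfl fun j _ => ?_
    ring

/-- The spherical average formula. -/
theorem avg_form {p : ℕ} (hp : 2 ≤ p) (μ : EuclideanSpace ℝ (Fin p)) (hμ : ‖μ‖ = 1)
    (f : ℝ → ℝ) (hf : Continuous f) (W : Matrix (Fin p) (Fin p) ℝ) :
      sphInt p (fun x => f ⟪μ, x⟫ * ⟪x, Matrix.toEuclideanLin W x⟫) =
        (W.trace - ⟪μ, Matrix.toEuclideanLin W μ⟫) / (p - 1) * sphInt p (fun x => f ⟪μ, x⟫) +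
        (p * ⟪μ, Matrix.toEuclideanLin W μ⟫ - W.trace) / (p - 1) *
          sphInt p (fun x => f ⟪μ, x⟫ * ⟪μ, x⟫ ^ 2) := by
  obtain ⟨c, d, h⟩ := bil_form hp μ hμ f hf
  have hμμ : ⟪μ, μ⟫ = 1 := by rw [real_inner_self_eq_norm_sq, hμ, one_pow]
  have h0 : sphInt p (fun x => f ⟪μ, x⟫) = c * p + d := by
    have h1 := h 1
    have : sphInt p (fun x => f ⟪μ, x⟫ * ⟪x, Matrix.toEuclideanLin 1 x⟫) =
        sphInt p (fun x => f ⟪μ, x⟫) := by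
      unfold sphInt
      congr 1; ext x
      have : ‖(x : EuclideanSpace ℝ (Fin p))‖ = 1 := by simp
      simp [Matrix.toLpLin_one, this]
    rw [this] at h1
    rw [h1]
    simp [Matrix.toLpLin_one, hμ]
  have h2 : sphInt p (fun x => f ⟪μ, x⟫ * ⟪μ, x⟫ ^ 2) = c + d := by
    have h1 := h (Matrix.of fun i j => μ i * μ j)
    have hq : ∀ x : EuclideanSpace ℝ (Fin p),
        ⟪x, Matrix.toEuclideanLin (Matrix.of fun i j => μ i * μ j) x⟫ = ⟪μ, x⟫ ^ 2 := by
      intro x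
      rw [inner_toEuc, sq, PiLp.inner_apply, Finset.sum_mul_sum]
      refine Finset.sum_congr rfl fun i _ => Finset.sum_congr rfl fun j _ => ?_
      simp; ring
    simp only [hq] at h1
    have ht : (Matrix.of fun i j => μ i * μ j).trace = 1 := by
      rw [← hμμ, PiLp.inner_apply, Matrix.trace]; simp [sq]
    rw [h1, ht, hμμ]; ring
  have hp' : (p : ℝ) - 1 ≠ 0 := by
    have : (2 : ℝ) ≤ p := by exact_mod_cast hp
    linarith
  rw [h, h0, h2]
  field_simp
  ring

theorem mul_sinh_nonneg (k : ℝ) (hk : 0 < k) (t : ℝ) : 0 ≤ t * Real.sinh (k * t) := by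
  rcases le_total 0 t with h | h
  · exact mul_nonneg h (Real.sinh_nonneg_iff.2 (mul_nonneg hk.le h))
  · exact mul_nonneg_of_nonpos_of_nonpos h
      (Real.sinh_nonpos_iff.2 (mul_nonpos_of_nonneg_of_nonpos hk.le h))

theorem pointwise_ineq (k : ℝ) (hk : 0 < k) (t s : ℝ) :
    0 ≤ (t ^ 2 - s ^ 2) * (t * Real.sinh (k * t) * Real.cosh (k * s)
      - s * Real.sinh (k * s) * Real.cosh (k * t)) := by
  have h1 := mul_sinh_nonneg k hk (t + s)
  have h2 := mul_sinh_nonneg k hk (t - s)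
  rw [mul_add, Real.sinh_add] at h1
  rw [mul_sub, Real.sinh_sub] at h2
  have h3 := mul_nonneg (sq_nonneg (t - s)) h1
  have h4 := mul_nonneg (sq_nonneg (t + s)) h2
  nlinarith

theorem sph_exp_pos {p : ℕ} (hp : 2 ≤ p) (g : EuclideanSpace ℝ (Fin p) → ℝ) (hg : Continuous g) :
    0 < sphInt p (fun x => Real.exp (g x)) := by
  haveI : Nontrivial (EuclideanSpace ℝ (Fin p)) := by
    haveI : Nonempty (Fin p) := ⟨⟨0, by omega⟩⟩
    infer_instance
  haveI : NeZero ((volume : Measure (EuclideanSpace ℝ (Fin p))).toSphere) :=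
    ⟨Measure.toSphere_ne_zero _⟩
  exact integral_exp_pos (sph_integrable_s18 (F := fun x => Real.exp (g x)) (by fun_prop))

/-- Even/odd symmetrization. -/
theorem sym_even {p : ℕ} (μ : EuclideanSpace ℝ (Fin p)) (k : ℝ) (n : ℕ) (hn : Even n) :
    sphInt p (fun x => ⟪μ, x⟫ ^ n * Real.cosh (k * ⟪μ, x⟫)) =
      sphInt p (fun x => ⟪μ, x⟫ ^ n * Real.exp (k * ⟪μ, x⟫)) := by
  have h := sphInt_neg (fun x => ⟪μ, x⟫ ^ n * Real.exp (k * ⟪μ, x⟫))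
  have e : (fun x => ⟪μ, x⟫ ^ n * Real.cosh (k * ⟪μ, x⟫)) = fun x : EuclideanSpace ℝ (Fin p) =>
    (1/2) * (⟪μ, x⟫ ^ n * Real.exp (k * ⟪μ, x⟫) + ⟪μ, -x⟫ ^ n * Real.exp (k * ⟪μ, -x⟫)) := by
    ext x
    rw [inner_neg_right, hn.neg_pow, Real.cosh_eq, mul_neg]; ring
  rw [e, sphInt_smul, sphInt_add (by fun_prop) (by fun_prop), h]; ring

theorem sym_odd {p : ℕ} (μ : EuclideanSpace ℝ (Fin p)) (k : ℝ) (n : ℕ) (hn : Odd n) :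
    sphInt p (fun x => ⟪μ, x⟫ ^ n * Real.sinh (k * ⟪μ, x⟫)) =
      sphInt p (fun x => ⟪μ, x⟫ ^ n * Real.exp (k * ⟪μ, x⟫)) := by
  have h := sphInt_neg (fun x => ⟪μ, x⟫ ^ n * Real.exp (k * ⟪μ, x⟫))
  have e : (fun x => ⟪μ, x⟫ ^ n * Real.sinh (k * ⟪μ, x⟫)) = fun x : EuclideanSpace ℝ (Fin p) =>
    (1/2) * (⟪μ, x⟫ ^ n * Real.exp (k * ⟪μ, x⟫) + ⟪μ, -x⟫ ^ n * Real.exp (k * ⟪μ, -x⟫)) := by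
    ext x
    rw [inner_neg_right, hn.neg_pow, Real.sinh_eq, mul_neg]; ring
  rw [e, sphInt_smul, sphInt_add (by fun_prop) (by fun_prop), h]; ring

theorem cov_ineq {p : ℕ} (hp : 2 ≤ p) (μ : EuclideanSpace ℝ (Fin p)) (k : ℝ) (hk : 0 < k) :
    sphInt p (fun x => ⟪μ, x⟫ ^ 1 * Real.exp (k * ⟪μ, x⟫)) *
      sphInt p (fun x => ⟪μ, x⟫ ^ 2 * Real.exp (k * ⟪μ, x⟫)) ≤
    sphInt p (fun x => ⟪μ, x⟫ ^ 3 * Real.exp (k * ⟪μ, x⟫)) *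
      sphInt p (fun x => ⟪μ, x⟫ ^ 0 * Real.exp (k * ⟪μ, x⟫)) := by
  have hC : 0 < sphInt p (fun x => ⟪μ, x⟫ ^ 0 * Real.exp (k * ⟪μ, x⟫)) := by
    simpa using sph_exp_pos hp (fun x => k * ⟪μ, x⟫) (by fun_prop)
  rw [← sym_odd μ k 1 (by decide), ← sym_odd μ k 3 (by decide), ← sym_even μ k 2 (by decide),
    ← sym_even μ k 0 (by decide)]
  rw [← sym_even μ k 0 (by decide)] at hC
  have hm2 : 0 ≤ sphInt p (fun x => ⟪μ, x⟫ ^ 2 * Real.cosh (k * ⟪μ, x⟫)) :=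
    sphInt_nonneg fun x => mul_nonneg (sq_nonneg _) (Real.cosh_pos _).le
  set C := sphInt p (fun x => ⟪μ, x⟫ ^ 0 * Real.cosh (k * ⟪μ, x⟫)) with hCd
  set A := sphInt p (fun x => ⟪μ, x⟫ ^ 1 * Real.sinh (k * ⟪μ, x⟫)) with hAd
  set m2 := sphInt p (fun x => ⟪μ, x⟫ ^ 2 * Real.cosh (k * ⟪μ, x⟫)) with hm2d
  set m3 := sphInt p (fun x => ⟪μ, x⟫ ^ 3 * Real.sinh (k * ⟪μ, x⟫)) with hm3d
  set s := Real.sqrt (m2 / C) with hs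
  have hs2 : s ^ 2 = m2 / C := Real.sq_sqrt (div_nonneg hm2 hC.le)
  have h : 0 ≤ Real.cosh (k * s) * (m3 - s ^ 2 * A)
      - (s * Real.sinh (k * s)) * (m2 - s ^ 2 * C) := by
    have h1 := sphInt_nonneg (p := p) fun x => pointwise_ineq k hk ⟪μ, x⟫ s
    have e : (fun x => (⟪μ, x⟫ ^ 2 - s ^ 2) * (⟪μ, x⟫ * Real.sinh (k * ⟪μ, x⟫) * Real.cosh (k * s)
      - s * Real.sinh (k * s) * Real.cosh (k * ⟪μ, x⟫))) = fun x =>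
      Real.cosh (k * s) * (⟪μ, x⟫ ^ 3 * Real.sinh (k * ⟪μ, x⟫)
        - s ^ 2 * (⟪μ, x⟫ ^ 1 * Real.sinh (k * ⟪μ, x⟫)))
      - (s * Real.sinh (k * s)) * (⟪μ, x⟫ ^ 2 * Real.cosh (k * ⟪μ, x⟫)
        - s ^ 2 * (⟪μ, x⟫ ^ 0 * Real.cosh (k * ⟪μ, x⟫))) := by
      ext x; ring
    rw [e, sphInt_sub (by fun_prop) (by fun_prop), sphInt_smul, sphInt_smul,
      sphInt_sub (by fun_prop) (by fun_prop), sphInt_sub (by fun_prop) (by fun_prop),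
      sphInt_smul, sphInt_smul] at h1
    exact h1
  have hz : m2 - s ^ 2 * C = 0 := by rw [hs2]; field_simp; ring
  rw [hz, mul_zero, sub_zero] at h
  have h3 := nonneg_of_mul_nonneg_right h (Real.cosh_pos _)
  have : m2 = s ^ 2 * C := by linarith
  rw [this]
  nlinarith

theorem inner_sph {p : ℕ} (v : EuclideanSpace ℝ (Fin p)) (F : EuclideanSpace ℝ (Fin p) → ℝ)
    (hF : Continuous F) :
    ⟪v, ∫ x : Metric.sphere (0 : EuclideanSpace ℝ (Fin p)) 1, F x • (x : EuclideanSpace ℝ (Fin p))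
      ∂((volume : Measure (EuclideanSpace ℝ (Fin p))).toSphere)⟫ =
      sphInt p (fun x => F x * ⟪v, x⟫) := by
  rw [← integral_inner (sph_integrable_s18 (F := fun x => F x • x) (by fun_prop))]
  simp only [real_inner_smul_right]
  rfl

/-- Theorem 2, integral form: For the surface measure σ on S^{p−1} ⊂ ℝ^p
(p ≥ 2), k > 0, μ ∈ S^{p−1}, and a symmetric p × p real matrix W with ‖Wv‖ ≤ ‖v‖ for
all v, if μᵀWμ ≥ (1/p) Tr W then
‖∫ (1 + xᵀWx) x e^{k⟨μ,x⟩} dσ‖ · ∫ e^{k⟨μ,x⟩} dσ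
  ≥ ‖∫ x e^{k⟨μ,x⟩} dσ‖ · ∫ (1 + xᵀWx) e^{k⟨μ,x⟩} dσ;
i.e. the resultant length of the Bayesian posterior is at least that of the prior. -/
theorem stmt18 (p : ℕ) (hp : 2 ≤ p) (k : ℝ) (hk : 0 < k)
    (μ : EuclideanSpace ℝ (Fin p)) (hμ : ‖μ‖ = 1)
    (W : Matrix (Fin p) (Fin p) ℝ) (hWsymm : W.IsSymm)
    (hWbound : ∀ v : EuclideanSpace ℝ (Fin p), ‖Matrix.toEuclideanLin W v‖ ≤ ‖v‖)
    (hcond : ⟪μ, Matrix.toEuclideanLin W μ⟫ ≥ (1 / (p : ℝ)) * W.trace) :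
    ‖∫ x : Metric.sphere (0 : EuclideanSpace ℝ (Fin p)) 1,
        ((1 + ⟪(x : EuclideanSpace ℝ (Fin p)),
            Matrix.toEuclideanLin W (x : EuclideanSpace ℝ (Fin p))⟫) *
          Real.exp (k * ⟪μ, (x : EuclideanSpace ℝ (Fin p))⟫)) •
          (x : EuclideanSpace ℝ (Fin p))
        ∂((volume : Measure (EuclideanSpace ℝ (Fin p))).toSphere)‖
      * (∫ x : Metric.sphere (0 : EuclideanSpace ℝ (Fin p)) 1,
          Real.exp (k * ⟪μ, (x : EuclideanSpace ℝ (Fin p))⟫)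
          ∂((volume : Measure (EuclideanSpace ℝ (Fin p))).toSphere))
    ≥ ‖∫ x : Metric.sphere (0 : EuclideanSpace ℝ (Fin p)) 1,
          Real.exp (k * ⟪μ, (x : EuclideanSpace ℝ (Fin p))⟫) •
            (x : EuclideanSpace ℝ (Fin p))
          ∂((volume : Measure (EuclideanSpace ℝ (Fin p))).toSphere)‖
      * (∫ x : Metric.sphere (0 : EuclideanSpace ℝ (Fin p)) 1,
          (1 + ⟪(x : EuclideanSpace ℝ (Fin p)),
              Matrix.toEuclideanLin W (x : EuclideanSpace ℝ (Fin p))⟫) *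
            Real.exp (k * ⟪μ, (x : EuclideanSpace ℝ (Fin p))⟫)
          ∂((volume : Measure (EuclideanSpace ℝ (Fin p))).toSphere)) := by
  have hcE : Continuous (fun x : EuclideanSpace ℝ (Fin p) => Matrix.toEuclideanLin W x) :=
    LinearMap.continuous_of_finiteDimensional _
  have hμμ : ⟪μ, μ⟫ = 1 := by rw [real_inner_self_eq_norm_sq, hμ, one_pow]
  set w := ⟪μ, Matrix.toEuclideanLin W μ⟫ with hw
  set P := ∫ x : Metric.sphere (0 : EuclideanSpace ℝ (Fin p)) 1,
        ((1 + ⟪(x : EuclideanSpace ℝ (Fin p)),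
            Matrix.toEuclideanLin W (x : EuclideanSpace ℝ (Fin p))⟫) *
          Real.exp (k * ⟪μ, (x : EuclideanSpace ℝ (Fin p))⟫)) •
          (x : EuclideanSpace ℝ (Fin p))
        ∂((volume : Measure (EuclideanSpace ℝ (Fin p))).toSphere) with hP
  set Q := ∫ x : Metric.sphere (0 : EuclideanSpace ℝ (Fin p)) 1,
          Real.exp (k * ⟪μ, (x : EuclideanSpace ℝ (Fin p))⟫) •
            (x : EuclideanSpace ℝ (Fin p))
          ∂((volume : Measure (EuclideanSpace ℝ (Fin p))).toSphere) with hQ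
  set m0 := sphInt p (fun x => ⟪μ, x⟫ ^ 0 * Real.exp (k * ⟪μ, x⟫)) with hm0
  set m1 := sphInt p (fun x => ⟪μ, x⟫ ^ 1 * Real.exp (k * ⟪μ, x⟫)) with hm1
  set m2 := sphInt p (fun x => ⟪μ, x⟫ ^ 2 * Real.exp (k * ⟪μ, x⟫)) with hm2
  set m3 := sphInt p (fun x => ⟪μ, x⟫ ^ 3 * Real.exp (k * ⟪μ, x⟫)) with hm3
  set a := (W.trace - w) / ((p : ℝ) - 1) with ha
  set b := (p * w - W.trace) / ((p : ℝ) - 1) with hb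
  have hp2 : (2 : ℝ) ≤ p := by exact_mod_cast hp
  have hb0 : 0 ≤ b := by
    apply div_nonneg _ (by linarith)
    have : (p : ℝ) * (1 / p * W.trace) ≤ p * w := mul_le_mul_of_nonneg_left hcond (by linarith)
    rw [← mul_assoc, mul_one_div_cancel (by linarith), one_mul] at this
    linarith
  have hcov : m1 * m2 ≤ m3 * m0 := cov_ineq hp μ k hk
  have hm0p : 0 < m0 := by
    simpa [hm0] using sph_exp_pos hp (fun x => k * ⟪μ, x⟫) (by fun_prop)
  have hm1n : 0 ≤ m1 := by
    rw [hm1, ← sym_odd μ k 1 (by decide)]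
    refine sphInt_nonneg fun x => ?_
    rw [pow_one]; exact mul_sinh_nonneg k hk _
  -- norm of the prior vector
  have hQn : ‖Q‖ = m1 := by
    have hQμ : ⟪μ, Q⟫ = m1 := by
      rw [hQ, inner_sph μ (fun x => Real.exp (k * ⟪μ, x⟫)) (by fun_prop), hm1]
      congr 1; ext x; ring
    have hQe : Q = m1 • μ := by
      refine ext_inner_left ℝ fun v => ?_
      set u := v - ⟪v, μ⟫ • μ with hu
      have huμ : ⟪u, μ⟫ = 0 := by
        rw [hu, inner_sub_left, real_inner_smul_left, hμμ]; ring
      have h0 : ⟪u, Q⟫ = 0 := by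
        have h := sphInt_rot μ u (-u) (by simp) (by rw [inner_neg_left, huμ, neg_zero])
          (fun s t => Real.exp (k * s) * t)
        rw [← inner_sph u (fun x => Real.exp (k * ⟪μ, x⟫)) (by fun_prop),
          ← inner_sph (-u) (fun x => Real.exp (k * ⟪μ, x⟫)) (by fun_prop), ← hQ,
          inner_neg_left] at h
        linarith
      have hv : v = u + ⟪v, μ⟫ • μ := by rw [hu]; abel
      rw [real_inner_smul_right]
      conv_lhs => rw [hv]
      rw [inner_add_left, h0, real_inner_smul_left, hQμ]; ring
    rw [hQe, norm_smul, hμ, mul_one, Real.norm_of_nonneg hm1n]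
  -- lower bound for the posterior vector
  have hPn : (1 + a) * m1 + b * m3 ≤ ‖P‖ := by
    have h1 : ⟪μ, P⟫ ≤ ‖P‖ := by
      simpa [hμ] using real_inner_le_norm μ P
    have h2 : ⟪μ, P⟫ = (1 + a) * m1 + b * m3 := by
      rw [hP, inner_sph μ (fun x => (1 + ⟪x, Matrix.toEuclideanLin W x⟫) *
        Real.exp (k * ⟪μ, x⟫)) (by fun_prop)]
      have e : (fun x => (1 + ⟪x, Matrix.toEuclideanLin W x⟫) * Real.exp (k * ⟪μ, x⟫) * ⟪μ, x⟫) =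
        fun x : EuclideanSpace ℝ (Fin p) => ⟪μ, x⟫ ^ 1 * Real.exp (k * ⟪μ, x⟫)
          + (⟪μ, x⟫ * Real.exp (k * ⟪μ, x⟫)) * ⟪x, Matrix.toEuclideanLin W x⟫ := by
        ext x; ring
      have h3 := avg_form hp μ hμ (fun t => t * Real.exp (k * t)) (by fun_prop) W
      rw [e, sphInt_add (by fun_prop) (by fun_prop), h3, ← hm1]
      have e1 : sphInt p (fun x => ⟪μ, x⟫ * Real.exp (k * ⟪μ, x⟫)) = m1 := by simp [hm1]
      have e3 : sphInt p (fun x => ⟪μ, x⟫ * Real.exp (k * ⟪μ, x⟫) * ⟪μ, x⟫ ^ 2) = m3 := by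
        rw [hm3]; congr 1; ext x; ring
      rw [e1, e3]; ring
    linarith
  have hI0 : (∫ x : Metric.sphere (0 : EuclideanSpace ℝ (Fin p)) 1,
          Real.exp (k * ⟪μ, (x : EuclideanSpace ℝ (Fin p))⟫)
          ∂((volume : Measure (EuclideanSpace ℝ (Fin p))).toSphere)) = m0 := by
    simp [hm0, sphInt]
  have hIW : (∫ x : Metric.sphere (0 : EuclideanSpace ℝ (Fin p)) 1,
          (1 + ⟪(x : EuclideanSpace ℝ (Fin p)),
              Matrix.toEuclideanLin W (x : EuclideanSpace ℝ (Fin p))⟫) *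
            Real.exp (k * ⟪μ, (x : EuclideanSpace ℝ (Fin p))⟫)
          ∂((volume : Measure (EuclideanSpace ℝ (Fin p))).toSphere)) = (1 + a) * m0 + b * m2 := by
    change sphInt p (fun x => (1 + ⟪x, Matrix.toEuclideanLin W x⟫) * Real.exp (k * ⟪μ, x⟫)) = _
    have e : (fun x => (1 + ⟪x, Matrix.toEuclideanLin W x⟫) * Real.exp (k * ⟪μ, x⟫)) =
        fun x : EuclideanSpace ℝ (Fin p) => ⟪μ, x⟫ ^ 0 * Real.exp (k * ⟪μ, x⟫)
          + Real.exp (k * ⟪μ, x⟫) * ⟪x, Matrix.toEuclideanLin W x⟫ := by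
      ext x; ring
    have h3 := avg_form hp μ hμ (fun t => Real.exp (k * t)) (by fun_prop) W
    rw [e, sphInt_add (by fun_prop) (by fun_prop), h3, ← hm0]
    have e1 : sphInt p (fun x => Real.exp (k * ⟪μ, x⟫)) = m0 := by simp [hm0]
    have e3 : sphInt p (fun x => Real.exp (k * ⟪μ, x⟫) * ⟪μ, x⟫ ^ 2) = m2 := by
      rw [hm2]; congr 1; ext x; ring
    rw [e1, e3]; ring
  rw [hI0, hIW, hQn]
  have h1 := mul_le_mul_of_nonneg_right hPn hm0p.le
  have h2 := mul_le_mul_of_nonneg_left hcov hb0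
  nlinarith
end
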